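/- arXiv:1810.03062 — 5 statements merged into one kernel-verified Lean document; each statement's English description precedes it below -/
import Mathlib

section
/- For every integer k ≥ 3 there exist marked groups (Γ,S) and (Δ,T) whose Cayley graphs Cay(Γ,S) and Cay(Δ,T) are isomorphic as graphs, such that: the Borel chromatic number of the shift graph of (Γ,S) equals k, the (ordinary) chromatic numbers of the shift graphs of (Γ,S) and (Δ,T) and of both Cayley graphs all equal k, and the Borel chromatic number of the shift graph of (Δ,T) equals k+1. -/
open Multiplicative

section Defs

variable {G : Type*} [Group G]

/-- The left shift action of `g : G` on `x : G → Bool` (`2^G` with `2 = Bool`):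
`(g · x)(h) = x (g⁻¹ h)`. -/
def shiftMap (g : G) (x : G → Bool) : G → Bool := fun h => x (g⁻¹ * h)

/-- The free part `F(2^G)` of the left shift action. -/
def FreePart (G : Type*) [Group G] : Set (G → Bool) :=
  {x | ∀ g : G, g ≠ 1 → shiftMap g x ≠ x}

/-- Adjacency in the shift graph of the marked group `(G, S)`: distinct `x, y ∈ F(2^G)`
are adjacent iff `y = s · x` for some `s ∈ S`. -/
def ShiftAdj (S : Set G) (x y : FreePart G) : Prop :=
  x ≠ y ∧ ∃ s ∈ S, (y : G → Bool) = shiftMap s (x : G → Bool)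

/-- Adjacency in the Cayley graph of `(G, S)`: distinct `g, h` are adjacent iff
`h = s * g` for some `s ∈ S`. -/
def CayleyAdj (S : Set G) (g h : G) : Prop :=
  g ≠ h ∧ ∃ s ∈ S, h = s * g

/-- `(G, S)` is a marked group: `S` is a finite symmetric generating set
not containing the identity. -/
def IsMarkedGroup (S : Set G) : Prop :=
  S.Finite ∧ (∀ s ∈ S, s⁻¹ ∈ S) ∧ (1 : G) ∉ S ∧ Subgroup.closure S = ⊤

end Defs

/-- A graph (given by its adjacency relation) has an `n`-coloring. -/
def HasColoring {X : Type*} (Adj : X → X → Prop) (n : ℕ) : Prop :=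
  ∃ c : X → Fin n, ∀ x y, Adj x y → c x ≠ c y

/-- The chromatic number: the least `n` admitting an `n`-coloring. -/
noncomputable def chromatic {X : Type*} (Adj : X → X → Prop) : ℕ :=
  sInf {n | HasColoring Adj n}

/-- A graph on a measurable space has a Borel `n`-coloring. -/
def HasBorelColoring {X : Type*} [MeasurableSpace X] (Adj : X → X → Prop) (n : ℕ) : Prop :=
  ∃ c : X → Fin n, Measurable c ∧ ∀ x y, Adj x y → c x ≠ c y

/-- The Borel chromatic number: the least `n` admitting a Borel `n`-coloring. -/
noncomputable def borelChromatic {X : Type*} [MeasurableSpace X] (Adj : X → X → Prop) : ℕ :=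
  sInf {n | HasBorelColoring Adj n}
/-- A marked group: a (finitely generated) group together with a finite symmetric
generating set not containing the identity. -/
structure MarkedGroup : Type 1 where
  /-- the underlying group -/
  carrier : Type
  [grp : Group carrier]
  /-- the distinguished generating set -/
  gens : Set carrier
  finite : gens.Finite
  symm : ∀ s ∈ gens, s⁻¹ ∈ gens
  one_not_mem : (1 : carrier) ∉ gens
  generates : Subgroup.closure gens = ⊤

attribute [instance] MarkedGroup.grp


section General

variable {G : Type*} [Group G]

theorem shiftMap_mul (g h : G) (x : G → Bool) :
    shiftMap (g * h) x = shiftMap g (shiftMap h x) := by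
  funext a; simp [shiftMap, mul_assoc]

theorem shiftMap_one (x : G → Bool) : shiftMap (1 : G) x = x := by
  funext a; simp [shiftMap]

theorem shiftMap_mem {x : G → Bool} (hx : x ∈ FreePart G) (g : G) :
    shiftMap g x ∈ FreePart G := by
  intro h hh e
  apply hx (g⁻¹ * h * g) (by
    intro h1
    apply hh
    have : h = g * (g⁻¹ * h * g) * g⁻¹ := by group
    rw [this, h1]; group)
  rw [mul_assoc, shiftMap_mul, shiftMap_mul, e, ← shiftMap_mul]
  simp [shiftMap_one]

instance freeAct : MulAction G (FreePart G) where
  smul g x := ⟨shiftMap g x.1, shiftMap_mem x.2 g⟩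
  one_smul x := Subtype.ext (shiftMap_one x.1)
  mul_smul g h x := Subtype.ext (shiftMap_mul g h x.1)

theorem smul_val (g : G) (x : FreePart G) : (g • x).1 = shiftMap g x.1 := rfl

theorem smul_ne {g : G} (hg : g ≠ 1) (x : FreePart G) : g • x ≠ x := fun h =>
  x.2 g hg (congrArg Subtype.val h)

theorem smul_inj_left {g h : G} {x : FreePart G} (e : g • x = h • x) : g = h := by
  by_contra hne
  apply smul_ne (g := h⁻¹ * g) (by
    intro h1; apply hne; exact (inv_mul_eq_one.mp h1).symm) x
  rw [mul_smul, e, inv_smul_smul]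

theorem shiftAdj_iff {S : Set G} {x y : FreePart G} :
    ShiftAdj S x y ↔ x ≠ y ∧ ∃ s ∈ S, y = s • x := by
  unfold ShiftAdj
  simp only [Subtype.ext_iff, smul_val]

theorem measurable_shiftMap (g : G) : Measurable (shiftMap g : (G → Bool) → G → Bool) := by
  unfold shiftMap; fun_prop

theorem measurable_act (g : G) : Measurable (fun x : FreePart G => g • x) :=
  Measurable.subtype_mk ((measurable_shiftMap g).comp measurable_subtype_coe)

theorem continuous_shiftMap (g : G) : Continuous (shiftMap g : (G → Bool) → G → Bool) := by
  unfold shiftMap; fun_prop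

/-- the Kechris-Solecki-Todorcevic greedy construction of a Borel maximal independent set -/
def greedy (D : Set G) (U : ℕ → Set (FreePart G)) : ℕ → Set (FreePart G)
  | 0 => ∅
  | n + 1 => greedy D U n ∪ {x | x ∈ U n ∧ ∀ d ∈ D, d • x ∉ greedy D U n}

theorem exists_marker [Countable G] (D : Set G) (hD : D.Finite) (hsymm : ∀ d ∈ D, d⁻¹ ∈ D)
    (h1 : (1 : G) ∉ D) :
    ∃ M : Set (FreePart G), MeasurableSet M ∧ (∀ x ∈ M, ∀ d ∈ D, d • x ∉ M) ∧
      ∀ x, x ∉ M → ∃ d ∈ D, d • x ∈ M := by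
  classical
  have : Finite D := hD
  let V : (D → G × Bool) → Set (FreePart G) := fun f =>
    {x | ∀ d : D, x.1 (f d).1 = (f d).2 ∧ x.1 ((d : G)⁻¹ * (f d).1) ≠ (f d).2}
  have hVm : ∀ f, MeasurableSet (V f) := by
    intro f
    have : V f = ⋂ d : D, ({x : FreePart G | x.1 (f d).1 = (f d).2} ∩
        {x : FreePart G | x.1 ((d : G)⁻¹ * (f d).1) = (f d).2}ᶜ) := by
      ext x; simp [V]
    rw [this]
    have key : ∀ (h : G) (b : Bool), MeasurableSet {x : FreePart G | x.1 h = b} := by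
      intro h b
      have : Measurable (fun x : FreePart G => x.1 h) :=
        (measurable_pi_apply h).comp measurable_subtype_coe
      exact this (measurableSet_singleton b)
    exact MeasurableSet.iInter fun d => (key _ _).inter (key _ _).compl
  have hVi : ∀ f, ∀ x ∈ V f, ∀ d ∈ D, d • x ∉ V f := by
    intro f x hx d hd h
    exact (hx ⟨d, hd⟩).2 (h ⟨d, hd⟩).1
  have hVc : ∀ x, ∃ f, x ∈ V f := by
    intro x
    have : ∀ d : D, ∃ h : G, x.1 ((d : G)⁻¹ * h) ≠ x.1 h := by
      intro d
      by_contra hcon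
      push Not at hcon
      exact x.2 d.1 (fun e => h1 (e ▸ d.2)) (funext hcon)
    choose h hh using this
    exact ⟨fun d => (h d, x.1 (h d)), fun d => ⟨rfl, hh d⟩⟩
  have : Nonempty (D → G × Bool) := ⟨fun _ => (1, true)⟩
  obtain ⟨en, hen⟩ := exists_surjective_nat (D → G × Bool)
  let U := fun n => V (en n)
  have hm : ∀ n, MeasurableSet (greedy D U n) := by
    intro n
    induction n with
    | zero => exact MeasurableSet.empty
    | succ n ih =>
      refine ih.union ?_
      have : {x | x ∈ U n ∧ ∀ d ∈ D, d • x ∉ greedy D U n} =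
          U n ∩ ⋂ d ∈ D, ((fun x : FreePart G => d • x) ⁻¹' greedy D U n)ᶜ := by
        ext x; simp
      rw [this]
      exact (hVm _).inter (MeasurableSet.biInter hD.countable fun d _ => (measurable_act d ih).compl)
  have hmono : Monotone (greedy D U) :=
    monotone_nat_of_le_succ fun n => Set.subset_union_left
  have hind : ∀ n, ∀ x ∈ greedy D U n, ∀ d ∈ D, d • x ∉ greedy D U n := by
    intro n
    induction n with
    | zero => intro x hx; exact hx.elim
    | succ n ih =>
      rintro x (hx | hx) d hd (h | h)
      · exact ih x hx d hd h
      · apply h.2 d⁻¹ (hsymm d hd)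
        rwa [inv_smul_smul]
      · exact hx.2 d hd h
      · exact hVi _ x hx.1 d hd h.1
  refine ⟨⋃ n, greedy D U n, MeasurableSet.iUnion hm, ?_, ?_⟩
  · intro x hx d hd h
    obtain ⟨n, hn⟩ := Set.mem_iUnion.1 hx
    obtain ⟨m, hm⟩ := Set.mem_iUnion.1 h
    exact hind (max n m) x (hmono (le_max_left _ _) hn) d hd (hmono (le_max_right _ _) hm)
  · intro x hx
    obtain ⟨f, hf⟩ := hVc x
    obtain ⟨n, rfl⟩ := hen f
    by_contra hcon
    push Not at hcon
    apply hx
    refine Set.mem_iUnion.2 ⟨n + 1, Or.inr ⟨hf, fun d hd h => hcon d hd (Set.mem_iUnion.2 ⟨n, h⟩)⟩⟩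

theorem freePart_residual [Countable G] [Infinite G] : FreePart G ∈ residual (G → Bool) := by
  classical
  have : FreePart G = ⋂ g : {g : G // g ≠ 1}, {x | shiftMap g.1 x ≠ x} := by
    ext x; simp [FreePart]
  rw [this, countable_iInter_mem]
  rintro ⟨g, hg⟩
  apply residual_of_dense_open
  · exact (isClosed_eq (continuous_shiftMap g) continuous_id).isOpen_compl
  · intro x
    rw [mem_closure_iff_nhds]
    intro t ht
    by_cases hx : shiftMap g x = x
    · rw [nhds_pi, Filter.mem_pi] at ht
      obtain ⟨I, hI, s, hs, hst⟩ := ht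
      obtain ⟨h, hh⟩ := hI.exists_notMem
      refine ⟨Function.update x h (!x h), hst ?_, ?_⟩
      · intro e he
        rw [Function.update_of_ne (by rintro rfl; exact hh he)]
        exact mem_of_mem_nhds (hs e)
      · intro e
        have e1 := congrFun e h
        have e2 := congrFun hx h
        simp only [shiftMap] at e1 e2
        rw [Function.update_self, Function.update_of_ne (by simpa using hg), e2] at e1
        simp at e1
    · exact ⟨x, mem_of_mem_nhds ht, hx⟩

theorem freePart_nonempty [Countable G] [Infinite G] : (FreePart G).Nonempty := by
  have := (dense_of_mem_residual (freePart_residual (G := G))).nonempty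
  exact this

/-- A Borel map on the free part to a finite set cannot be moved by elements going to infinity. -/
theorem exists_recurrent [Countable G] [Infinite G] {Y : Type*} [Finite Y]
    [MeasurableSpace Y] [MeasurableSingletonClass Y]
    (f : FreePart G → Y) (hf : Measurable f) (P : Set G)
    (hP : ∀ E : Set G, E.Finite → ∃ g ∈ P, ∀ e ∈ E, g * e ∉ E) :
    ∃ g ∈ P, ∃ x, f (g • x) = f x := by
  classical
  have hB : ∀ y, ∃ B : Set (G → Bool), MeasurableSet B ∧ Subtype.val ⁻¹' B = f ⁻¹' {y} :=
    fun y => hf (measurableSet_singleton y)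
  choose B hBm hB using hB
  have hnm : ∃ y, ¬ IsMeagre (B y) := by
    by_contra hcon
    push Not at hcon
    have h1 : IsMeagre (⋃ y, B y) := isMeagre_iUnion hcon
    have h2 := Filter.inter_mem h1 (freePart_residual (G := G))
    obtain ⟨x, hx1, hx2⟩ := (dense_of_mem_residual h2).nonempty
    apply hx1
    refine Set.mem_iUnion.2 ⟨f ⟨x, hx2⟩, ?_⟩
    have : (⟨x, hx2⟩ : FreePart G) ∈ f ⁻¹' {f ⟨x, hx2⟩} := rfl
    rw [← hB] at this
    exact this
  obtain ⟨y, hy⟩ := hnm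
  obtain ⟨U, hU, hBU⟩ := (hBm y).baireMeasurableSet.residualEq_isOpen
  have hUne : U.Nonempty := by
    by_contra hne
    rw [Set.not_nonempty_iff_eq_empty] at hne
    subst hne
    apply hy
    filter_upwards [hBU] with x hx hxB
    exact hx.mp hxB
  obtain ⟨u, hu⟩ := hUne
  have hun := hU.mem_nhds hu
  rw [nhds_pi, Filter.mem_pi] at hun
  obtain ⟨I, hI, s, hs, hst⟩ := hun
  obtain ⟨g, hgP, hg⟩ := hP I hI
  have hg' : shiftMap g⁻¹ ∘ shiftMap g = (id : (G → Bool) → G → Bool) := by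
    funext x; simp [← shiftMap_mul, shiftMap_one]
  let φ : (G → Bool) ≃ₜ (G → Bool) :=
    { toFun := shiftMap g
      invFun := shiftMap g⁻¹
      left_inv := fun x => by simp [← shiftMap_mul, shiftMap_one]
      right_inv := fun x => by simp [← shiftMap_mul, shiftMap_one]
      continuous_toFun := continuous_shiftMap g
      continuous_invFun := continuous_shiftMap g⁻¹ }
  have hR : {x | x ∈ FreePart G ∧ (x ∈ B y ↔ x ∈ U)} ∈ residual (G → Bool) := by
    filter_upwards [freePart_residual, hBU] with x h1 h2
    exact ⟨h1, Eq.to_iff h2⟩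
  have hR2 : (shiftMap g) ⁻¹' {x | x ∈ FreePart G ∧ (x ∈ B y ↔ x ∈ U)} ∈ residual (G → Bool) :=
    tendsto_residual_of_isOpenMap φ.continuous φ.isOpenMap hR
  have hne : (U ∩ shiftMap g ⁻¹' U).Nonempty := by
    refine ⟨fun e => if e ∈ I then u e else u (g * e), hst ?_, hst ?_⟩
    · intro e he
      simp only [he, if_true]
      exact mem_of_mem_nhds (hs e)
    · intro e he
      have : g⁻¹ * e ∉ I := fun h => hg _ h (by simpa using he)
      simp only [shiftMap, this, if_false, mul_inv_cancel_left]
      exact mem_of_mem_nhds (hs e)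
  obtain ⟨x, ⟨hxU, hgU⟩, ⟨hx1, hx2⟩, ⟨hx3, hx4⟩⟩ :=
    (dense_of_mem_residual (Filter.inter_mem hR hR2)).inter_open_nonempty _
      (hU.inter (hU.preimage (continuous_shiftMap g))) hne
  have key : ∀ z : FreePart G, z.1 ∈ B y → f z = y := by
    intro z hz
    have : z ∈ Subtype.val ⁻¹' B y := hz
    rw [hB] at this
    exact this
  refine ⟨g, hgP, ⟨x, hx1⟩, ?_⟩
  rw [key ⟨x, hx1⟩ (hx2.2 hxU), key (g • ⟨x, hx1⟩) (hx4.2 hgU)]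

end General

/-- The semidirect product of `ℤ` with `ℤ/k`, the generator of `ℤ` acting through the unit `ε`. -/
@[ext]
structure Gp (k : ℕ) (ε : (ZMod k)ˣ) where
  /-- the finite coordinate -/
  j : ZMod k
  /-- the integer coordinate -/
  i : ℤ

namespace Gp

variable {k : ℕ} {ε : (ZMod k)ˣ}

instance : Mul (Gp k ε) := ⟨fun g h => ⟨g.j + ((ε ^ g.i : (ZMod k)ˣ) : ZMod k) * h.j, g.i + h.i⟩⟩
instance : One (Gp k ε) := ⟨⟨0, 0⟩⟩
instance : Inv (Gp k ε) := ⟨fun g => ⟨-(((ε ^ (-g.i) : (ZMod k)ˣ) : ZMod k) * g.j), -g.i⟩⟩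

theorem mul_def (g h : Gp k ε) :
    g * h = ⟨g.j + ((ε ^ g.i : (ZMod k)ˣ) : ZMod k) * h.j, g.i + h.i⟩ := rfl
theorem one_def : (1 : Gp k ε) = ⟨0, 0⟩ := rfl
theorem inv_def (g : Gp k ε) :
    g⁻¹ = ⟨-(((ε ^ (-g.i) : (ZMod k)ˣ) : ZMod k) * g.j), -g.i⟩ := rfl

instance : Group (Gp k ε) :=
  Group.ofLeftAxioms
    (by
      intro a b c
      simp only [mul_def, zpow_add, Units.val_mul]
      ext
      · simp only; ring
      · simp only; ring)
    (by intro a; simp [mul_def, one_def])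
    (by intro a; simp [mul_def, one_def, inv_def])

theorem mul_mk (a b : ZMod k) (m n : ℤ) :
    (⟨a, m⟩ * ⟨b, n⟩ : Gp k ε) = ⟨a + ((ε ^ m : (ZMod k)ˣ) : ZMod k) * b, m + n⟩ := rfl

theorem zero_mul_mk (a b : ZMod k) (n : ℤ) :
    (⟨a, 0⟩ * ⟨b, n⟩ : Gp k ε) = ⟨a + b, n⟩ := by simp [mul_mk]

theorem one_mul_mk (a b : ZMod k) (n : ℤ) :
    (⟨a, 1⟩ * ⟨b, n⟩ : Gp k ε) = ⟨a + ε * b, n + 1⟩ := by simp [mul_mk, add_comm]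

/-- coordinates as a product -/
def equivProd : Gp k ε ≃ ZMod k × ℤ :=
  ⟨fun g => (g.j, g.i), fun p => ⟨p.1, p.2⟩, fun _ => rfl, fun _ => rfl⟩

instance [NeZero k] : Countable (Gp k ε) := (equivProd (ε := ε)).countable_iff.2 inferInstance
instance : Infinite (Gp k ε) := (equivProd (ε := ε)).infinite_iff.2 inferInstance

theorem finite_band [NeZero k] (N : ℤ) : {g : Gp k ε | |g.i| ≤ N}.Finite := by
  have : {g : Gp k ε | |g.i| ≤ N} =
      (equivProd (ε := ε)) ⁻¹' ((Set.univ : Set (ZMod k)) ×ˢ (Set.Icc (-N) N)) := by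
    ext g; simp [equivProd, abs_le]
  rw [this]
  exact (Set.finite_univ.prod (Set.finite_Icc _ _)).preimage (equivProd.injective.injOn)

/-- forward generators -/
def fwd (g : Gp k ε) : Prop := g.i = 1 ∧ g.j ≠ 0 ∧ g.j ≠ ε

/-- the generating set -/
def gset (k : ℕ) (ε : (ZMod k)ˣ) : Set (Gp k ε) :=
  {g | (g.i = 0 ∧ g.j ≠ 0) ∨ fwd g ∨ fwd g⁻¹}

theorem gset_inv {g : Gp k ε} (h : g ∈ gset k ε) : g⁻¹ ∈ gset k ε := by
  rcases h with h | h | h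
  · left
    obtain ⟨h1, h2⟩ := h
    simp [inv_def, h1, h2]
  · right; right; rwa [inv_inv]
  · right; left; exact h

theorem one_notMem : (1 : Gp k ε) ∉ gset k ε := by
  simp [gset, fwd, one_def, inv_def]

theorem gset_finite [NeZero k] : (gset k ε).Finite := by
  apply (finite_band (ε := ε) 1).subset
  rintro g (h | h | h)
  · simp [h.1]
  · simp [h.1]
  · have := h.1
    simp only [inv_def] at this
    have : g.i = -1 := by omega
    simp [this]

theorem exists_good (hk : 3 ≤ k) (ε : (ZMod k)ˣ) : ∃ d : ZMod k, d ≠ 0 ∧ d ≠ ε := by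
  have : NeZero k := ⟨by omega⟩
  have h : ({0, (ε : ZMod k)} : Finset (ZMod k)).card < (Finset.univ : Finset (ZMod k)).card := by
    rw [Finset.card_univ, ZMod.card]
    exact lt_of_le_of_lt Finset.card_le_two (by omega)
  obtain ⟨d, -, hd⟩ := Finset.exists_mem_notMem_of_card_lt_card h
  simp only [Finset.mem_insert, Finset.mem_singleton, not_or] at hd
  exact ⟨d, hd⟩

theorem gset_gen (hk : 3 ≤ k) : Subgroup.closure (gset k ε) = ⊤ := by
  rw [eq_top_iff]
  rintro g -
  set H := Subgroup.closure (gset k ε)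
  have h0 : ∀ a : ZMod k, (⟨a, 0⟩ : Gp k ε) ∈ H := by
    intro a
    by_cases ha : a = 0
    · subst ha; exact H.one_mem
    · exact Subgroup.subset_closure (Or.inl ⟨rfl, ha⟩)
  obtain ⟨d, hd⟩ := exists_good hk ε
  have ht : (⟨0, 1⟩ : Gp k ε) ∈ H := by
    have h1 : (⟨d, 1⟩ : Gp k ε) ∈ H := Subgroup.subset_closure (Or.inr (Or.inl ⟨rfl, hd⟩))
    have := H.mul_mem (h0 (-d)) h1
    rwa [zero_mul_mk, neg_add_cancel] at this
  have htn : ∀ n : ℤ, (⟨0, n⟩ : Gp k ε) ∈ H := by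
    intro n
    have : (⟨0, n⟩ : Gp k ε) = ⟨0, 1⟩ ^ n := by
      induction n using Int.induction_on with
      | zero => rfl
      | succ n ih => rw [zpow_add_one, ← ih, mul_mk]; simp
      | pred n ih => rw [zpow_sub_one, ← ih, inv_def, mul_mk]; simp; ring
    rw [this]
    exact H.zpow_mem ht n
  have := H.mul_mem (h0 g.j) (htn g.i)
  rwa [zero_mul_mk, add_zero] at this

theorem mul_inv_j (g h : Gp k ε) (hi : h.i = g.i + 1) : h * g⁻¹ = ⟨h.j - ε * g.j, 1⟩ := by
  have : h = ⟨h.j - ε * g.j, 1⟩ * g := by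
    obtain ⟨j, i⟩ := g
    rw [one_mul_mk]
    ext <;> simp [hi]
  rw [mul_inv_eq_iff_eq_mul]
  exact this

theorem mul_inv_j0 (g h : Gp k ε) (hi : h.i = g.i) : h * g⁻¹ = ⟨h.j - g.j, 0⟩ := by
  rw [mul_inv_eq_iff_eq_mul]
  obtain ⟨j, i⟩ := g
  rw [zero_mul_mk]
  ext <;> simp [hi]

/-- forward adjacency in coordinates -/
def fadj (g h : Gp k ε) : Prop := h.i = g.i + 1 ∧ h.j - ε * g.j ≠ 0 ∧ h.j - ε * g.j ≠ ε

theorem fwd_iff (g h : Gp k ε) : fwd (h * g⁻¹) ↔ fadj g h := by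
  by_cases hi : h.i = g.i + 1
  · rw [mul_inv_j g h hi]
    simp [fwd, fadj, hi]
  · have : (h * g⁻¹).i ≠ 1 := by
      simp only [mul_def, inv_def]; omega
    simp [fwd, fadj, hi, this]

theorem cayleyAdj_iff (g h : Gp k ε) : CayleyAdj (gset k ε) g h ↔
    (h.i = g.i ∧ h.j ≠ g.j) ∨ fadj g h ∨ fadj h g := by
  have h1 : CayleyAdj (gset k ε) g h ↔ h * g⁻¹ ∈ gset k ε := by
    constructor
    · rintro ⟨-, s, hs, rfl⟩
      simpa using hs
    · intro hm
      refine ⟨?_, _, hm, by simp⟩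
      rintro rfl
      rw [mul_inv_cancel] at hm
      exact one_notMem hm
  rw [h1]
  show (_ ∨ _ ∨ _) ↔ _
  rw [mul_inv_rev, inv_inv, fwd_iff, fwd_iff]
  apply or_congr _ Iff.rfl
  by_cases hi : h.i = g.i
  · rw [mul_inv_j0 g h hi]
    simp [hi, sub_eq_zero]
  · have : (h * g⁻¹).i ≠ 0 := by
      simp only [mul_def, inv_def]; omega
    simp [hi, this]

/-- slice-wise reflection -/
def twist (i : ℤ) (j : ZMod k) : ZMod k := if Even i then j - (i / 2 : ℤ) else -j + (i / 2 : ℤ)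

theorem twist_inj (i : ℤ) : Function.Injective (twist (k := k) i) := by
  intro a b h
  unfold twist at h
  split_ifs at h <;> simpa using h

theorem twist_surj (i : ℤ) : Function.Surjective (twist (k := k) i) := by
  intro a
  unfold twist
  split_ifs
  · exact ⟨a + (i / 2 : ℤ), by ring⟩
  · exact ⟨-a + (i / 2 : ℤ), by ring⟩

/-- the map realizing the isomorphism of Cayley graphs -/
def isoFun (g : Gp k 1) : Gp k (-1) := ⟨twist g.i g.j, g.i⟩

theorem isoFun_bij : Function.Bijective (isoFun (k := k)) := by
  constructor
  · rintro ⟨a, m⟩ ⟨b, n⟩ h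
    simp only [isoFun, Gp.mk.injEq] at h
    obtain ⟨h1, rfl⟩ := h
    rw [twist_inj _ h1]
  · rintro ⟨a, m⟩
    obtain ⟨b, rfl⟩ := twist_surj m a
    exact ⟨⟨b, m⟩, rfl⟩

theorem fadj_iso (g h : Gp k 1) : fadj (isoFun g) (isoFun h) ↔ fadj g h := by
  obtain ⟨a, m⟩ := g
  obtain ⟨b, n⟩ := h
  simp only [fadj, isoFun]
  apply and_congr_right
  rintro rfl
  simp only [Units.val_neg, Units.val_one, neg_mul, one_mul, sub_neg_eq_add]
  rcases Int.even_or_odd' m with ⟨c, rfl | rfl⟩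
  · have e1 : Even (2 * c) := by simp
    have e2 : ¬ Even (2 * c + 1) := by simp
    have e3 : 2 * c / 2 = c := by omega
    have e4 : (2 * c + 1) / 2 = c := by omega
    simp only [twist, e1, e2, if_true, if_false, e3, e4]
    constructor
    · rintro ⟨h1, h2⟩
      exact ⟨fun h => h1 (by linear_combination -h), fun h => h2 (by linear_combination -h)⟩
    · rintro ⟨h1, h2⟩
      exact ⟨fun h => h1 (by linear_combination -h), fun h => h2 (by linear_combination -h)⟩
  · have e1 : Even (2 * c + 1 + 1) := ⟨c + 1, by ring⟩
    have e2 : ¬ Even (2 * c + 1) := by simp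
    have e3 : (2 * c + 1 + 1) / 2 = c + 1 := by omega
    have e4 : (2 * c + 1) / 2 = c := by omega
    simp only [twist, e1, e2, if_true, if_false, e3, e4]
    push_cast
    constructor
    · rintro ⟨h1, h2⟩
      exact ⟨fun h => h2 (by linear_combination h), fun h => h1 (by linear_combination h)⟩
    · rintro ⟨h1, h2⟩
      exact ⟨fun h => h2 (by linear_combination h), fun h => h1 (by linear_combination h)⟩

theorem cayley_iso (g h : Gp k 1) : CayleyAdj (gset k 1) g h ↔
    CayleyAdj (gset k (-1)) (isoFun g) (isoFun h) := by
  rw [cayleyAdj_iff, cayleyAdj_iff, fadj_iso, fadj_iso]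
  apply or_congr _ Iff.rfl
  apply and_congr_right
  intro hi
  simp only [isoFun]
  have hi : h.i = g.i := hi
  rw [hi, (twist_inj g.i).ne_iff]

/-- the marked group -/
def marked (k : ℕ) (hk : 3 ≤ k) (ε : (ZMod k)ˣ) : MarkedGroup :=
  haveI : NeZero k := ⟨by omega⟩
  { carrier := Gp k ε
    gens := gset k ε
    finite := gset_finite
    symm := fun _ => gset_inv
    one_not_mem := one_notMem
    generates := gset_gen hk }

end Gp

namespace Gp

variable {k : ℕ} {ε : (ZMod k)ˣ}

theorem coloring_of {C : Type*} (c : FreePart (Gp k ε) → C)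
    (h1 : ∀ x (a : ZMod k), a ≠ 0 → c ((⟨a, 0⟩ : Gp k ε) • x) ≠ c x)
    (h2 : ∀ x (d : ZMod k), d ≠ 0 → d ≠ ε → c ((⟨d, 1⟩ : Gp k ε) • x) ≠ c x)
    (x y) (h : ShiftAdj (gset k ε) x y) : c x ≠ c y := by
  rw [shiftAdj_iff] at h
  obtain ⟨-, s, hs, rfl⟩ := h
  rcases hs with hs | hs | hs
  · obtain ⟨a, i⟩ := s
    obtain ⟨rfl, ha⟩ := hs
    exact (h1 x a ha).symm
  · obtain ⟨d, i⟩ := s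
    obtain ⟨rfl, hd⟩ := hs
    exact (h2 x d hd.1 hd.2).symm
  · set u := s⁻¹ with hu
    have : x = u • (s • x) := by rw [hu, inv_smul_smul]
    obtain ⟨d, i⟩ := u
    obtain ⟨rfl, hd⟩ := hs
    have h3 := h2 (s • x) d hd.1 hd.2
    rwa [← this] at h3

theorem coloring_slice {C : Type*} {c : FreePart (Gp k ε) → C}
    (hc : ∀ x y, ShiftAdj (gset k ε) x y → c x ≠ c y) (x) (a : ZMod k) (ha : a ≠ 0) :
    c ((⟨a, 0⟩ : Gp k ε) • x) ≠ c x := by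
  refine (hc _ _ (shiftAdj_iff.2 ⟨?_, ⟨a, 0⟩, Or.inl ⟨rfl, ha⟩, rfl⟩)).symm
  exact (smul_ne (by simpa [one_def] using ha) x).symm

theorem coloring_fwd {C : Type*} {c : FreePart (Gp k ε) → C}
    (hc : ∀ x y, ShiftAdj (gset k ε) x y → c x ≠ c y) (x) (d : ZMod k) (hd : d ≠ 0)
    (hd' : d ≠ ε) : c ((⟨d, 1⟩ : Gp k ε) • x) ≠ c x := by
  refine (hc _ _ (shiftAdj_iff.2 ⟨?_, ⟨d, 1⟩, Or.inr (Or.inl ⟨rfl, hd, hd'⟩), rfl⟩)).symm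
  exact (smul_ne (by simp [one_def]) x).symm

/-- `L`, `l` describe the next marker after the marker `m` -/
def Nxt (M : Set (FreePart (Gp k ε))) (L : ℕ) (l : ZMod k) : Set (FreePart (Gp k ε)) :=
  {m | m ∈ M ∧ (⟨l, L⟩ : Gp k ε) • m ∈ M ∧
    ∀ (i : ℕ) (j : ZMod k), 0 < i → i < L → (⟨j, i⟩ : Gp k ε) • m ∉ M}

theorem nxt_meas [NeZero k] {M : Set (FreePart (Gp k ε))} (hM : MeasurableSet M)
    (L : ℕ) (l : ZMod k) : MeasurableSet (Nxt M L l) := by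
  have : Nxt M L l = M ∩ ((fun x => (⟨l, L⟩ : Gp k ε) • x) ⁻¹' M ∩
      ⋂ (i : ℕ) (j : ZMod k) (_ : 0 < i) (_ : i < L),
        ((fun x => (⟨j, i⟩ : Gp k ε) • x) ⁻¹' M)ᶜ) := by
    ext x
    simp [Nxt]
    tauto
  rw [this]
  refine hM.inter ((measurable_act _ hM).inter ?_)
  exact MeasurableSet.iInter fun i => MeasurableSet.iInter fun j => MeasurableSet.iInter fun _ =>
    MeasurableSet.iInter fun _ => (measurable_act _ hM).compl

section

variable {M : Set (FreePart (Gp k ε))} {N : ℕ}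

theorem nxt_exists (sep : ∀ m ∈ M, ∀ g : Gp k ε, |g.i| ≤ N → g • m ∈ M → g = 1)
    (syn : ∀ x, ∃ g : Gp k ε, |g.i| ≤ N ∧ g • x ∈ M) (m) (hm : m ∈ M) :
    ∃ (L : ℕ) (l : ZMod k), N < L ∧ m ∈ Nxt M L l := by
  classical
  have hex : ∃ L : ℕ, 0 < L ∧ ∃ l : ZMod k, (⟨l, L⟩ : Gp k ε) • m ∈ M := by
    obtain ⟨g, hg, hgM⟩ := syn ((⟨0, N + 1⟩ : Gp k ε) • m)
    rw [← mul_smul] at hgM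
    have := abs_le.1 hg
    refine ⟨(g.i + N + 1).toNat, by omega, (g * (⟨0, N + 1⟩ : Gp k ε)).j, ?_⟩
    have e : ((g.i + N + 1).toNat : ℤ) = (g * (⟨0, N + 1⟩ : Gp k ε)).i := by
      simp only [mul_def]; omega
    rw [e]
    exact hgM
  obtain ⟨h0, l, hl⟩ := Nat.find_spec hex
  refine ⟨Nat.find hex, l, ?_, hm, hl, ?_⟩
  · by_contra hcon
    have := sep m hm _ (by simp only [Nat.abs_cast]; omega) hl
    simp only [one_def, Gp.mk.injEq] at this
    omega
  · intro i j hi hiL hmem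
    exact Nat.find_min hex hiL ⟨hi, j, hmem⟩

theorem mk_inv_mul (r r' : ZMod k) (n n' : ℕ) (h : n ≤ n') :
    ∃ j, ((⟨r, n⟩ : Gp k ε)⁻¹ * ⟨r', n'⟩) = ⟨j, (n' - n : ℕ)⟩ := by
  refine ⟨_, Gp.ext rfl ?_⟩
  simp only [mul_def, inv_def]
  omega

theorem nxt_decomp (sep : ∀ m ∈ M, ∀ g : Gp k ε, |g.i| ≤ N → g • m ∈ M → g = 1)
    (syn : ∀ x, ∃ g : Gp k ε, |g.i| ≤ N ∧ g • x ∈ M) (x) :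
    ∃ (m : FreePart (Gp k ε)) (L : ℕ) (l : ZMod k) (n : ℕ) (r : ZMod k),
      N < L ∧ m ∈ Nxt M L l ∧ n < L ∧ x = (⟨r, n⟩ : Gp k ε) • m := by
  classical
  have hex : ∃ n : ℕ, ∃ j : ZMod k, (⟨j, -n⟩ : Gp k ε) • x ∈ M := by
    obtain ⟨g, hg, hgM⟩ := syn ((⟨0, -N⟩ : Gp k ε) • x)
    rw [← mul_smul] at hgM
    have := abs_le.1 hg
    refine ⟨(N - g.i).toNat, (g * (⟨0, -N⟩ : Gp k ε)).j, ?_⟩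
    have e : (-((N - g.i).toNat : ℤ)) = (g * (⟨0, -N⟩ : Gp k ε)).i := by
      simp only [mul_def]; omega
    rw [e]
    exact hgM
  obtain ⟨j, hj⟩ := Nat.find_spec hex
  have hmin := fun {m} => Nat.find_min (m := m) hex
  set n := Nat.find hex
  obtain ⟨L, l, hL, hm⟩ := nxt_exists sep syn _ hj
  refine ⟨_, L, l, n, ((⟨j, -n⟩ : Gp k ε)⁻¹).j, hL, hm, ?_, ?_⟩
  · by_contra hcon
    apply hmin (m := n - L) (by omega)
    have h2 := hm.2.1
    rw [← mul_smul] at h2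
    refine ⟨((⟨l, L⟩ : Gp k ε) * ⟨j, -n⟩).j, ?_⟩
    have e : (-((n - L : ℕ) : ℤ)) = ((⟨l, L⟩ : Gp k ε) * ⟨j, -n⟩).i := by
      simp only [mul_def]; omega
    rw [e]
    exact h2
  · have : (⟨((⟨j, -n⟩ : Gp k ε)⁻¹).j, n⟩ : Gp k ε) = (⟨j, -n⟩ : Gp k ε)⁻¹ := by
      ext <;> simp [inv_def]
    rw [this, inv_smul_smul]

theorem nxt_unique1 (sep : ∀ m ∈ M, ∀ g : Gp k ε, |g.i| ≤ N → g • m ∈ M → g = 1)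
    {m m' : FreePart (Gp k ε)} {L L' : ℕ} {l l' : ZMod k} {n n' : ℕ} {r r' : ZMod k}
    (hm : m ∈ Nxt M L l) (hm' : m' ∈ Nxt M L' l') (hn' : n' < L')
    (e : (⟨r, n⟩ : Gp k ε) • m = (⟨r', n'⟩ : Gp k ε) • m') (hle : n ≤ n') :
    n = n' ∧ m = m' ∧ r = r' := by
  obtain ⟨j, hj⟩ := mk_inv_mul (ε := ε) r r' n n' hle
  have h1 : m = (⟨j, (n' - n : ℕ)⟩ : Gp k ε) • m' := by
    rw [← hj, mul_smul, ← e, inv_smul_smul]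
  have hnn : n = n' := by
    by_contra hne
    apply hm'.2.2 (n' - n) j (by omega) (by omega)
    rw [← h1]
    exact hm.1
  subst hnn
  have h2 := sep m' hm'.1 ⟨j, (n - n : ℕ)⟩ (by simp) (by rw [← h1]; exact hm.1)
  rw [h2, one_smul] at h1
  subst h1
  have := smul_inj_left e
  simp only [Gp.mk.injEq, and_true] at this
  exact ⟨rfl, rfl, this⟩

theorem nxt_unique2 (sep : ∀ m ∈ M, ∀ g : Gp k ε, |g.i| ≤ N → g • m ∈ M → g = 1)
    {m : FreePart (Gp k ε)} {L L' : ℕ} {l l' : ZMod k}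
    (hm : m ∈ Nxt M L l) (hm' : m ∈ Nxt M L' l') (h0 : 0 < L) (h0' : 0 < L') :
    L = L' ∧ l = l' := by
  have hL : L = L' := by
    rcases lt_trichotomy L L' with h | h | h
    · exact (hm'.2.2 L l h0 h hm.2.1).elim
    · exact h
    · exact (hm.2.2 L' l' h0' h hm'.2.1).elim
  subst hL
  refine ⟨rfl, ?_⟩
  have e : (⟨l' - l, 0⟩ : Gp k ε) • (⟨l, L⟩ : Gp k ε) • m = (⟨l', L⟩ : Gp k ε) • m := by
    rw [← mul_smul, zero_mul_mk, sub_add_cancel]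
  have := sep _ hm.2.1 (⟨l' - l, 0⟩ : Gp k ε) (by simp) (by rw [e]; exact hm'.2.1)
  simp only [one_def, Gp.mk.injEq, and_true] at this
  exact (sub_eq_zero.1 this).symm

end

theorem borel_of_path [NeZero k] (n : ℕ) (p0 : ZMod k → Fin n) (N : ℕ)
    (path : ℕ → ZMod k → ℕ → ZMod k → Fin n)
    (h0 : ∀ L > N, ∀ l, path L l 0 = p0)
    (hL : ∀ L > N, ∀ l j, path L l L j = p0 (j - l))
    (hinj : ∀ L > N, ∀ l i, Function.Injective (path L l i))
    (hR : ∀ L > N, ∀ l i r d, d ≠ 0 → d ≠ (ε : ZMod k) →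
      path L l (i + 1) (d + ε * r) ≠ path L l i r) :
    HasBorelColoring (ShiftAdj (gset k ε)) n := by
  obtain ⟨M, hM, hM1, hM2⟩ := exists_marker ({g : Gp k ε | |g.i| ≤ N} \ {1})
    ((finite_band (ε := ε) N).subset Set.sdiff_subset)
    (by
      rintro d ⟨h1, h2⟩
      refine ⟨?_, by simpa using h2⟩
      simpa [inv_def] using h1) (by simp)
  have sep : ∀ m ∈ M, ∀ g : Gp k ε, |g.i| ≤ N → g • m ∈ M → g = 1 := by
    intro m hm g hg hgm
    by_contra hne
    exact hM1 m hm g ⟨hg, hne⟩ hgm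
  have syn : ∀ x, ∃ g : Gp k ε, |g.i| ≤ N ∧ g • x ∈ M := by
    intro x
    by_cases hx : x ∈ M
    · exact ⟨1, by simp [one_def], by simpa using hx⟩
    · obtain ⟨d, hd, hdx⟩ := hM2 x hx
      exact ⟨d, hd.1, hdx⟩
  have dec := nxt_decomp sep syn
  choose fm fL fl fn fr f1 f2 f3 f4 using dec
  let c : FreePart (Gp k ε) → Fin n := fun x => path (fL x) (fl x) (fn x) (fr x)
  have hc : ∀ m L l i r, m ∈ Nxt M L l → i < L → c ((⟨r, (i : ℕ)⟩ : Gp k ε) • m) = path L l i r := by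
    intro m L l i r hm hi
    set x := (⟨r, (i : ℕ)⟩ : Gp k ε) • m with hx
    have e := hx.symm.trans (f4 x)
    have key : i = fn x ∧ m = fm x ∧ r = fr x := by
      rcases le_total i (fn x) with h | h
      · exact nxt_unique1 sep hm (f2 x) (f3 x) e h
      · obtain ⟨a, b, c⟩ := nxt_unique1 sep (f2 x) hm hi e.symm h
        exact ⟨a.symm, b.symm, c.symm⟩
    obtain ⟨k1, k2, k3⟩ := key
    have h2 := f2 x
    rw [← k2] at h2
    obtain ⟨k4, k5⟩ := nxt_unique2 sep hm h2 (by omega) (by have := f1 x; omega)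
    show path _ _ _ _ = _
    rw [← k1, ← k3, ← k4, ← k5]
  refine ⟨c, ?_, coloring_of c ?_ ?_⟩
  · apply measurable_to_countable'
    intro v
    have : c ⁻¹' {v} = ⋃ (L : ℕ) (l : ZMod k) (i : ℕ) (r : ZMod k) (_ : i < L)
        (_ : path L l i r = v), (fun x => (⟨r, i⟩ : Gp k ε)⁻¹ • x) ⁻¹' Nxt M L l := by
      ext x
      simp only [Set.mem_preimage, Set.mem_singleton_iff, Set.mem_iUnion, exists_prop]
      constructor
      · intro hx
        refine ⟨fL x, fl x, fn x, fr x, f3 x, hx, ?_⟩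
        have := f2 x
        rwa [← inv_smul_eq_iff.2 (f4 x)] at this
      · rintro ⟨L, l, i, r, hi, hv, hx⟩
        have := hc _ L l i r hx hi
        rwa [smul_inv_smul, hv] at this
    rw [this]
    exact MeasurableSet.iUnion fun L => MeasurableSet.iUnion fun l => MeasurableSet.iUnion fun i =>
      MeasurableSet.iUnion fun r => MeasurableSet.iUnion fun _ => MeasurableSet.iUnion fun _ =>
        measurable_act _ (nxt_meas hM L l)
  · intro x a ha
    obtain ⟨m, L, l, i, r, g1, g2, g3, rfl⟩ := nxt_decomp sep syn x
    rw [← mul_smul, zero_mul_mk, hc _ _ _ _ _ g2 g3, hc _ _ _ _ _ g2 g3]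
    intro h
    have := hinj L g1 l i h
    exact ha (by simpa using this)
  · intro x d hd hd'
    obtain ⟨m, L, l, i, r, g1, g2, g3, rfl⟩ := nxt_decomp sep syn x
    rw [← mul_smul, one_mul_mk, hc _ _ _ _ _ g2 g3]
    have ei : (i : ℤ) + 1 = ((i + 1 : ℕ) : ℤ) := by push_cast; rfl
    rw [ei]
    have hne := hR L g1 l i r d hd hd'
    by_cases hi : i + 1 < L
    · rw [hc _ _ _ _ _ g2 hi]
      exact hne
    · have hiL : i + 1 = L := by omega
      rw [hiL] at hne ⊢
      have e : (⟨d + ε * r, L⟩ : Gp k ε) • m =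
          (⟨d + ε * r - l, (0 : ℕ)⟩ : Gp k ε) • (⟨l, L⟩ : Gp k ε) • m := by
        rw [← mul_smul, Nat.cast_zero, zero_mul_mk, sub_add_cancel]
      obtain ⟨L', l', q1, q2⟩ := nxt_exists sep syn _ g2.2.1
      rw [e, hc _ _ _ _ _ q2 (by omega), h0 L' q1, ← hL L g1]
      exact hne

theorem slice_step [NeZero k] {c : FreePart (Gp k (-1)) → Fin k}
    (hc : ∀ x y, ShiftAdj (gset k (-1)) x y → c x ≠ c y) (x) :
    ∃ e : ZMod k, ∀ s : ZMod k, c ((⟨s, 1⟩ : Gp k (-1)) • x) = c ((⟨-s + e, 0⟩ : Gp k (-1)) • x) := by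
  have inj : ∀ y, Function.Injective (fun s : ZMod k => c ((⟨s, 0⟩ : Gp k (-1)) • y)) := by
    intro y a b hab
    by_contra hne
    apply coloring_slice hc ((⟨b, 0⟩ : Gp k (-1)) • y) (a - b) (sub_ne_zero.2 hne)
    rw [← mul_smul, zero_mul_mk, sub_add_cancel]
    exact hab
  have surj : Function.Surjective (fun s : ZMod k => c ((⟨s, 0⟩ : Gp k (-1)) • x)) := by
    have := (Fintype.bijective_iff_injective_and_card _).2 ⟨inj x, by simp⟩
    exact this.2
  have hr : ∀ s : ZMod k, ∃ r : ZMod k,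
      c ((⟨r, 0⟩ : Gp k (-1)) • x) = c ((⟨s, 1⟩ : Gp k (-1)) • x) := fun s => surj _
  choose r hr using hr
  have hr2 : ∀ s, r s = -s ∨ r s = -s + -1 := by
    intro s
    by_contra hcon
    push Not at hcon
    apply coloring_fwd hc ((⟨r s, 0⟩ : Gp k (-1)) • x) (s + r s)
    · intro h; exact hcon.1 (by linear_combination h)
    · intro h
      simp only [Units.val_neg, Units.val_one] at h
      exact hcon.2 (by linear_combination h)
    · rw [← mul_smul, one_mul_mk, hr]
      simp
  have rinj : Function.Injective r := by
    intro a b hab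
    have : c ((⟨a, 1⟩ : Gp k (-1)) • x) = c ((⟨b, 1⟩ : Gp k (-1)) • x) := by
      rw [← hr, ← hr, hab]
    apply inj ((⟨0, 1⟩ : Gp k (-1)) • x)
    simp only [← mul_smul, zero_mul_mk, add_zero]
    exact this
  by_cases h : ∃ s, r s = -s
  · obtain ⟨s, hs⟩ := h
    have all : ∀ n : ℕ, r (s - n) = -(s - n) := by
      intro n
      induction n with
      | zero => simpa using hs
      | succ n ih =>
        rcases hr2 (s - (n + 1 : ℕ)) with h | h
        · exact h
        · have h3 : r (s - (n + 1 : ℕ)) = r (s - n) := by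
            rw [h, ih]; push_cast; ring
          have h4 := rinj h3
          push_cast at h4 h ⊢
          rw [h]
          linear_combination h4
    refine ⟨0, fun t => ?_⟩
    have h5 := all (s - t).val
    rw [ZMod.natCast_zmod_val] at h5
    rw [← hr t]
    have h6 : s - (s - t) = t := by ring
    rw [h6] at h5
    rw [h5, add_zero]
  · push Not at h
    refine ⟨-1, fun t => ?_⟩
    rw [← hr t, (hr2 t).resolve_left (h t)]

theorem slice_iter [NeZero k] {c : FreePart (Gp k (-1)) → Fin k}
    (hc : ∀ x y, ShiftAdj (gset k (-1)) x y → c x ≠ c y) (x) (n : ℕ) :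
    ∃ e : ZMod k, ∀ s : ZMod k,
      c ((⟨s, n⟩ : Gp k (-1)) • x) = c ((⟨(-1) ^ n * s + e, 0⟩ : Gp k (-1)) • x) := by
  induction n with
  | zero => exact ⟨0, fun s => by simp⟩
  | succ n ih =>
    obtain ⟨e, he⟩ := ih
    obtain ⟨e', he'⟩ := slice_step hc ((⟨0, n⟩ : Gp k (-1)) • x)
    refine ⟨(-1) ^ n * e' + e, fun s => ?_⟩
    have h1 := he' s
    rw [← mul_smul, ← mul_smul, zero_mul_mk, one_mul_mk] at h1
    push_cast
    simp only [mul_zero, add_zero] at h1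
    rw [h1, he]
    congr 3
    ring

theorem no_borel (hk : 3 ≤ k) : ¬ HasBorelColoring (ShiftAdj (gset k (-1))) k := by
  have : NeZero k := ⟨by omega⟩
  rintro ⟨c, hcm, hc⟩
  obtain ⟨g, ⟨n, rfl⟩, x, hx⟩ := exists_recurrent (Y := ZMod k → Fin k)
    (fun x s => c ((⟨s, 0⟩ : Gp k (-1)) • x))
    (measurable_pi_lambda _ fun s => hcm.comp (measurable_act _))
    (Set.range fun n : ℕ => (⟨0, (2 * n + 1 : ℕ)⟩ : Gp k (-1)))
    (by
      intro E hE
      have hb : ∃ B : ℕ, ∀ e ∈ E, |e.i| ≤ B := by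
        obtain ⟨b, hb⟩ := (hE.image fun e => |e.i|).bddAbove
        refine ⟨b.toNat, fun e he => ?_⟩
        have : |e.i| ≤ b := hb ⟨e, he, rfl⟩
        omega
      obtain ⟨B, hB⟩ := hb
      refine ⟨_, ⟨B, rfl⟩, fun e he h => ?_⟩
      have h1 := abs_le.1 (hB e he)
      have h2 := abs_le.1 (hB _ h)
      simp only [mul_def] at h2
      push_cast at h2
      omega)
  obtain ⟨e, he⟩ := slice_iter hc x (2 * n + 1)
  have hneg : ∀ s : ZMod k, c ((⟨-s + e, 0⟩ : Gp k (-1)) • x) = c ((⟨s, 0⟩ : Gp k (-1)) • x) := by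
    intro s
    have h1 := congrFun hx s
    simp only [← mul_smul, zero_mul_mk, add_zero] at h1
    rw [← h1, he]
    congr 3
    rw [pow_succ, pow_mul]
    simp
  have hs : ∀ s : ZMod k, -s + e = s := by
    intro s
    by_contra hne
    apply coloring_slice hc ((⟨s, 0⟩ : Gp k (-1)) • x) (-s + e - s) (sub_ne_zero.2 hne)
    rw [← mul_smul, zero_mul_mk, sub_add_cancel, hneg]
  have h0 := hs 0
  have h1 := hs 1
  have h2 : ((2 : ℕ) : ZMod k) = 0 := by
    push_cast
    linear_combination h0 - h1
  rw [ZMod.natCast_eq_zero_iff] at h2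
  have := Nat.le_of_dvd (by norm_num) h2
  omega

end Gp

namespace Gp

variable {k : ℕ} {ε : (ZMod k)ˣ}

theorem borel_pos (hk : 3 ≤ k) : HasBorelColoring (ShiftAdj (gset k 1)) k := by
  have : NeZero k := ⟨by omega⟩
  let p0 : ZMod k ≃ Fin k := Fintype.equivFinOfCardEq (ZMod.card k)
  refine borel_of_path k p0 k (fun _ l i j => p0 (j - (min i l.val : ℕ))) ?_ ?_ ?_ ?_
  · intro L _ l
    funext j
    simp
  · intro L hL l j
    have : min L l.val = l.val := min_eq_right (by have := ZMod.val_lt l; omega)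
    simp only [this, ZMod.natCast_zmod_val]
  · intro L _ l i a b h
    simpa using h
  · intro L _ l i r d hd hd' h
    have h1 := p0.injective h
    simp only [Units.val_one, one_mul] at h1 hd'
    have h2 : min (i + 1) l.val = min i l.val ∨ min (i + 1) l.val = min i l.val + 1 := by omega
    rcases h2 with h2 | h2
    · rw [h2] at h1
      exact hd (by linear_combination h1)
    · rw [h2] at h1
      push_cast at h1
      exact hd' (by linear_combination h1)

/-- one recoloring step -/
def Step {A C : Type*} (p q : A → C) : Prop := ∀ r s, q s = p r → s = r

/-- walks of length `L` through injective functions -/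
def Wk {A C : Type*} (p q : A → C) (L : ℕ) : Prop :=
  ∃ h : ℕ → A → C, h 0 = p ∧ h L = q ∧ (∀ i, Function.Injective (h i)) ∧
    ∀ i, Step (h i) (h (i + 1))

theorem step_refl {A C : Type*} {p : A → C} (hp : Function.Injective p) : Step p p :=
  fun _ _ h => hp h

theorem wk_cons {A C : Type*} {p p' q : A → C} {L : ℕ} (hp : Function.Injective p)
    (hs : Step p p') (h : Wk p' q L) : Wk p q (L + 1) := by
  obtain ⟨f, f0, fL, finj, fs⟩ := h
  refine ⟨fun i => Nat.casesOn i p f, rfl, fL, ?_, ?_⟩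
  · rintro (_ | i)
    · exact hp
    · exact finj i
  · rintro (_ | i)
    · show Step p (f 0)
      rw [f0]; exact hs
    · exact fs i

theorem wk_mono {A C : Type*} {p q : A → C} {L L' : ℕ} (h : Wk p q L) (hL : L ≤ L') :
    Wk p q L' := by
  obtain ⟨f, f0, fL, finj, fs⟩ := h
  refine ⟨fun i => f (min i L), by simpa using f0, by simpa [hL] using fL, fun i => finj _, ?_⟩
  intro i
  rcases lt_or_ge i L with h | h
  · have h1 : min i L = i := by omega
    have h2 : min (i + 1) L = i + 1 := by omega
    simp only [h1, h2]
    exact fs i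
  · have h1 : min i L = L := by omega
    have h2 : min (i + 1) L = L := by omega
    simp only [h1, h2]
    exact step_refl (finj L)

theorem update_step {A C : Type*} [DecidableEq A] {p : A → C} (hp : Function.Injective p) (a : A)
    (v : C) (hv : ∀ b, p b ≠ v) :
    Step p (Function.update p a v) ∧ Function.Injective (Function.update p a v) := by
  constructor
  · intro r s h
    by_cases hs : s = a
    · subst hs
      rw [Function.update_self] at h
      exact (hv r h.symm).elim
    · rw [Function.update_of_ne hs] at h
      exact hp h
  · intro b b' h
    by_cases hb : b = a
    · by_cases hb' : b' = a
      · rw [hb, hb']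
      · subst hb
        rw [Function.update_self, Function.update_of_ne hb'] at h
        exact (hv b' h.symm).elim
    · by_cases hb' : b' = a
      · subst hb'
        rw [Function.update_self, Function.update_of_ne hb] at h
        exact (hv b h).elim
      · rw [Function.update_of_ne hb, Function.update_of_ne hb'] at h
        exact hp h

theorem wk_exists {A C : Type*} [Fintype A] [DecidableEq A] [Fintype C] [DecidableEq C]
    (hcard : Fintype.card A < Fintype.card C) (n : ℕ) :
    ∀ p q : A → C, Function.Injective p → Function.Injective q →
      (Finset.univ.filter fun a => p a ≠ q a).card ≤ n → ∃ L, Wk p q L := by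
  induction n with
  | zero =>
    intro p q hp hq h
    have : p = q := by
      funext a
      by_contra hne
      have : a ∈ Finset.univ.filter fun a => p a ≠ q a := by simpa using hne
      rw [Finset.card_eq_zero.1 (Nat.le_zero.1 h)] at this
      simp at this
    subst this
    exact ⟨0, fun _ => p, rfl, rfl, fun _ => hp, fun _ => step_refl hp⟩
  | succ n ih =>
    intro p q hp hq h
    -- the easy case: a disagreement whose target color is free
    have easy : ∀ p : A → C, Function.Injective p →
        (Finset.univ.filter fun a => p a ≠ q a).card ≤ n + 1 → ∀ a, p a ≠ q a →
        (∀ b, p b ≠ q a) → ∃ L, Wk p q L := by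
      intro p hp h a ha hfree
      obtain ⟨s1, s2⟩ := update_step hp a (q a) hfree
      obtain ⟨L, hL⟩ := ih _ q s2 hq (by
        have hlt : (Finset.univ.filter fun b => Function.update p a (q a) b ≠ q b).card <
            (Finset.univ.filter fun b => p b ≠ q b).card := by
          apply Finset.card_lt_card
          rw [Finset.ssubset_iff_of_subset]
          · exact ⟨a, by simpa using ha, by simp⟩
          · intro b hb
            simp only [Finset.mem_filter, Finset.mem_univ, true_and] at hb ⊢
            by_cases hba : b = a
            · subst hba; exact ha
            · rwa [Function.update_of_ne hba] at hb
        omega)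
      exact ⟨L + 1, wk_cons hp s1 hL⟩
    by_cases hpq : ∃ a, p a ≠ q a
    · obtain ⟨a, ha⟩ := hpq
      by_cases hfree : ∀ b, p b ≠ q a
      · exact easy p hp h a ha hfree
      · push Not at hfree
        obtain ⟨b, hb⟩ := hfree
        have hba : b ≠ a := by rintro rfl; exact ha hb
        have hbq : p b ≠ q b := by
          rw [hb]; intro e; exact hba (hq e).symm
        have hhole : ∃ v, ∀ b, p b ≠ v := by
          by_contra hcon
          push Not at hcon
          exact absurd (Fintype.card_le_of_surjective p hcon) (by omega)
        obtain ⟨v, hv⟩ := hhole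
        obtain ⟨s1, s2⟩ := update_step hp b v hv
        obtain ⟨L, hL⟩ := easy _ s2 (by
          refine le_trans (Finset.card_le_card ?_) h
          intro e he
          simp only [Finset.mem_filter, Finset.mem_univ, true_and] at he ⊢
          by_cases heb : e = b
          · subst heb; exact hbq
          · rwa [Function.update_of_ne heb] at he) a
          (by rwa [Function.update_of_ne hba.symm])
          (by
            intro e
            by_cases heb : e = b
            · subst heb
              rw [Function.update_self, ← hb]
              exact (hv e).symm
            · rw [Function.update_of_ne heb, ← hb]
              exact fun h => heb (hp h))
        exact ⟨L + 1, wk_cons hp s1 hL⟩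
    · push Not at hpq
      have : p = q := funext hpq
      subst this
      exact ⟨0, fun _ => p, rfl, rfl, fun _ => hp, fun _ => step_refl hp⟩

theorem borel_neg (hk : 3 ≤ k) : HasBorelColoring (ShiftAdj (gset k (-1))) (k + 1) := by
  classical
  have : NeZero k := ⟨by omega⟩
  let e0 : ZMod k ≃ Fin k := Fintype.equivFinOfCardEq (ZMod.card k)
  let p0 : ZMod k → Fin (k + 1) := fun j => (e0 j).castSucc
  have hp0 : Function.Injective p0 := (Fin.castSucc_injective k).comp e0.injective
  have hW : ∀ q : ZMod k → Fin (k + 1), ∃ L, Function.Injective q → Wk p0 q L := by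
    intro q
    by_cases hq : Function.Injective q
    · obtain ⟨L, hL⟩ := wk_exists (by simp) _ p0 q hp0 hq le_rfl
      exact ⟨L, fun _ => hL⟩
    · exact ⟨0, fun h => (hq h).elim⟩
  choose Lq hLq using hW
  let N := Finset.univ.sup Lq
  have hsq : ∀ i : ℕ, ((-1 : ZMod k) ^ i) * (-1) ^ i = 1 := by
    intro i; rw [← mul_pow]; simp
  have hpw : ∀ i : ℕ, Function.Injective (fun j : ZMod k => (-1 : ZMod k) ^ i * j) := by
    intro i a b h
    have h : (-1 : ZMod k) ^ i * a = (-1 : ZMod k) ^ i * b := h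
    linear_combination (-1 : ZMod k) ^ i * h - (a - b) * hsq i
  have hwalk : ∀ (L : ℕ) (l : ZMod k), ∃ f : ℕ → ZMod k → Fin (k + 1), L > N →
      (f 0 = p0 ∧ f L = (fun j => p0 ((-1) ^ L * j - l)) ∧
        (∀ i, Function.Injective (f i)) ∧ ∀ i, Step (f i) (f (i + 1))) := by
    intro L l
    by_cases hL : L > N
    · have hq : Function.Injective (fun j : ZMod k => p0 ((-1) ^ L * j - l)) := by
        intro a b h
        exact hpw L (sub_left_injective (hp0 h))
      obtain ⟨f, hf⟩ := wk_mono (hLq _ hq)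
        (le_trans (Finset.le_sup (f := Lq) (Finset.mem_univ _)) hL.le)
      exact ⟨f, fun _ => hf⟩
    · exact ⟨fun _ => p0, fun h => (hL h).elim⟩
  choose f hf using hwalk
  refine borel_of_path (k + 1) p0 N (fun L l i j => f L l i ((-1) ^ i * j)) ?_ ?_ ?_ ?_
  · intro L hL l
    funext j
    simp [(hf L l hL).1]
  · intro L hL l j
    simp only [(hf L l hL).2.1]
    rw [← mul_assoc, hsq, one_mul]
  · intro L hL l i
    exact ((hf L l hL).2.2.1 i).comp (hpw i)
  · intro L hL l i r d hd _ h
    have h1 := (hf L l hL).2.2.2 i _ _ h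
    simp only [Units.val_neg, Units.val_one, pow_succ] at h1
    apply hd
    linear_combination -(-1 : ZMod k) ^ i * h1 - d * hsq i

theorem chromatic_eq {X : Type*} {Adj : X → X → Prop} {n : ℕ} (h : HasColoring Adj n)
    (hl : ∀ m, HasColoring Adj m → n ≤ m) : chromatic Adj = n :=
  le_antisymm (Nat.sInf_le h) (hl _ (Nat.sInf_mem (s := {n | HasColoring Adj n}) ⟨n, h⟩))

theorem borelChromatic_eq {X : Type*} [MeasurableSpace X] {Adj : X → X → Prop} {n : ℕ}
    (h : HasBorelColoring Adj n)
    (hl : ∀ m, HasBorelColoring Adj m → n ≤ m) : borelChromatic Adj = n :=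
  le_antisymm (Nat.sInf_le h) (hl _ (Nat.sInf_mem (s := {n | HasBorelColoring Adj n}) ⟨n, h⟩))

theorem hasColoring_of_borel {X : Type*} [MeasurableSpace X] {Adj : X → X → Prop} {n : ℕ}
    (h : HasBorelColoring Adj n) : HasColoring Adj n := by
  obtain ⟨c, -, hc⟩ := h
  exact ⟨c, hc⟩

theorem borel_mono {X : Type*} [MeasurableSpace X] {Adj : X → X → Prop} {n m : ℕ}
    (h : HasBorelColoring Adj n) (hnm : n ≤ m) : HasBorelColoring Adj m := by
  obtain ⟨c, hm, hc⟩ := h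
  refine ⟨fun x => Fin.castLE hnm (c x), (measurable_of_countable (Fin.castLE hnm)).comp hm, fun x y hxy e => ?_⟩
  exact hc x y hxy (Fin.castLE_injective hnm e)

theorem cayley_of_shift [NeZero k] {n : ℕ} (h : HasColoring (ShiftAdj (gset k ε)) n) :
    HasColoring (CayleyAdj (gset k ε)) n := by
  obtain ⟨c, hc⟩ := h
  obtain ⟨x, hx⟩ := freePart_nonempty (G := Gp k ε)
  refine ⟨fun g => c (g • ⟨x, hx⟩), ?_⟩
  rintro g h ⟨hne, s, hs, rfl⟩
  apply hc
  rw [shiftAdj_iff]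
  refine ⟨fun e => hne (smul_inj_left e), s, hs, by rw [mul_smul]⟩

theorem shift_of_cayley {n : ℕ} (h : HasColoring (CayleyAdj (gset k ε)) n) :
    HasColoring (ShiftAdj (gset k ε)) n := by
  obtain ⟨c, hc⟩ := h
  have hrep : ∀ x : FreePart (Gp k ε), ∃ g : Gp k ε,
      x = g • (Quotient.mk (MulAction.orbitRel (Gp k ε) (FreePart (Gp k ε))) x).out := by
    intro x
    have h1 : (MulAction.orbitRel (Gp k ε) (FreePart (Gp k ε))) _ x :=
      Quotient.mk_out (s := MulAction.orbitRel (Gp k ε) (FreePart (Gp k ε))) x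
    have h2 := Setoid.symm' _ h1
    rw [MulAction.orbitRel_apply] at h2
    obtain ⟨g, hg⟩ := h2
    exact ⟨g, hg.symm⟩
  choose γ hγ using hrep
  refine ⟨fun x => c (γ x), ?_⟩
  intro x y hxy
  rw [shiftAdj_iff] at hxy
  obtain ⟨hne, s, hs, rfl⟩ := hxy
  have hq : Quotient.mk (MulAction.orbitRel (Gp k ε) (FreePart (Gp k ε))) (s • x) =
      Quotient.mk (MulAction.orbitRel (Gp k ε) (FreePart (Gp k ε))) x :=
    Quotient.sound (s := MulAction.orbitRel (Gp k ε) (FreePart (Gp k ε))) ⟨s, rfl⟩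
  have h1 := hγ (s • x)
  rw [hq] at h1
  have h2 : γ (s • x) = s * γ x := by
    apply smul_inj_left (x := (Quotient.mk (MulAction.orbitRel (Gp k ε)
      (FreePart (Gp k ε))) x).out)
    rw [← h1, mul_smul, ← hγ x]
  apply hc
  refine ⟨?_, s, hs, h2⟩
  rw [h2]
  intro e
  have : s = 1 := by simpa using e.symm
  exact one_notMem (this ▸ hs)

theorem clique_bound [NeZero k] {n : ℕ} (h : HasColoring (CayleyAdj (gset k ε)) n) : k ≤ n := by
  obtain ⟨c, hc⟩ := h
  have : Function.Injective (fun j : ZMod k => c ⟨j, 0⟩) := by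
    intro a b hab
    by_contra hne
    exact hc ⟨a, 0⟩ ⟨b, 0⟩ ((cayleyAdj_iff _ _).2 (Or.inl ⟨rfl, fun h => hne h.symm⟩)) hab
  simpa using Fintype.card_le_of_injective _ this

end Gp

/-- For every `k ≥ 3` there are marked groups `(Γ, S)` and `(Δ, T)`
with isomorphic Cayley graphs such that the Borel chromatic number of the shift graph of
`(Γ, S)` equals `k`, the chromatic numbers of both shift graphs and both Cayley graphs
all equal `k`, and the Borel chromatic number of the shift graph of `(Δ, T)` equals
`k + 1`. -/
theorem exists_marked_groups_iso_cayley_different_borel_chromatic (k : ℕ) (hk : 3 ≤ k) :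
    ∃ M N : MarkedGroup,
      (∃ e : M.carrier ≃ N.carrier,
        ∀ g h : M.carrier, CayleyAdj M.gens g h ↔ CayleyAdj N.gens (e g) (e h)) ∧
      borelChromatic (ShiftAdj M.gens) = k ∧
      chromatic (ShiftAdj M.gens) = k ∧
      chromatic (ShiftAdj N.gens) = k ∧
      chromatic (CayleyAdj M.gens) = k ∧
      chromatic (CayleyAdj N.gens) = k ∧
      borelChromatic (ShiftAdj N.gens) = k + 1 := by
  have : NeZero k := ⟨by omega⟩
  have b1 := Gp.borel_pos hk
  have b2 := Gp.borel_neg hk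
  have s1 := Gp.hasColoring_of_borel b1
  have c1 := Gp.cayley_of_shift s1
  have c2 : HasColoring (CayleyAdj (Gp.gset k (-1))) k := by
    obtain ⟨c, hc⟩ := c1
    let e := Equiv.ofBijective _ (Gp.isoFun_bij (k := k))
    refine ⟨fun g => c (e.symm g), fun g h hgh => hc _ _ ?_⟩
    rw [Gp.cayley_iso]
    have h1 : Gp.isoFun (e.symm g) = g := e.apply_symm_apply g
    have h2 : Gp.isoFun (e.symm h) = h := e.apply_symm_apply h
    rwa [h1, h2]
  have s2 := Gp.shift_of_cayley c2
  refine ⟨Gp.marked k hk 1, Gp.marked k hk (-1),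
    ⟨Equiv.ofBijective _ Gp.isoFun_bij, Gp.cayley_iso⟩, ?_, ?_, ?_, ?_, ?_, ?_⟩
  · exact Gp.borelChromatic_eq b1 fun m hm =>
      Gp.clique_bound (Gp.cayley_of_shift (Gp.hasColoring_of_borel hm))
  · exact Gp.chromatic_eq s1 fun m hm => Gp.clique_bound (Gp.cayley_of_shift hm)
  · exact Gp.chromatic_eq s2 fun m hm => Gp.clique_bound (Gp.cayley_of_shift hm)
  · exact Gp.chromatic_eq c1 fun m hm => Gp.clique_bound hm
  · exact Gp.chromatic_eq c2 fun m hm => Gp.clique_bound hm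
  · refine Gp.borelChromatic_eq b2 fun m hm => ?_
    by_contra hcon
    exact Gp.no_borel hk (Gp.borel_mono hm (by omega))
end

section
/- Let (Γ,S) be an infinite marked group. Then the Borel chromatic number of the shift graph of (Γ,S) is greater than 2; that is, there is no Borel map c : F(2^Γ) → {1,2} assigning distinct values to adjacent vertices of the shift graph. -/
open Multiplicative

theorem aux_countable {G : Type*} [Group G] (S : Set G) (hf : S.Finite)
    (hc : Subgroup.closure S = ⊤) : Countable G := by
  have : Countable S := hf.countable.to_subtype
  have hfree : Countable (FreeGroup S) := by
    unfold FreeGroup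
    infer_instance
  have hs : Function.Surjective (FreeGroup.lift (fun s : S => (s : G))) := by
    rw [← MonoidHom.range_eq_top, FreeGroup.range_lift_eq_closure]
    simpa using hc
  exact hs.countable

theorem aux_diag {X Y : Type*} [MeasurableSpace X] [MeasurableSpace Y] (f : ℕ → X → Y)
    (hf : ∀ n, Measurable (f n)) (N : X → ℕ) (hN : Measurable N) :
    Measurable (fun x => f (N x) x) := by
  intro t ht
  have : (fun x => f (N x) x) ⁻¹' t = ⋃ n, (N ⁻¹' {n} ∩ f n ⁻¹' t) := by
    ext x
    simp
  rw [this]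
  exact MeasurableSet.iUnion fun n =>
    (hN (measurableSet_singleton n)).inter (hf n ht)

theorem aux_pick : ∃ p : Fin 3 × Fin 3 → Fin 3, ∀ a b, p (a, b) ≠ a ∧ p (a, b) ≠ b := by
  have : ∀ q : Fin 3 × Fin 3, ∃ r : Fin 3, r ≠ q.1 ∧ r ≠ q.2 := by decide
  choose p hp using this
  exact ⟨p, fun a b => hp (a, b)⟩

open Classical in
/-- Greedy colouring along a countable colouring `φ`. -/
noncomputable def auxD {X : Type*} (p : Fin 3 × Fin 3 → Fin 3) (T T' : X → X) (φ : X → ℕ) :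
    ℕ → X → Fin 3
  | 0 => fun _ => 0
  | n + 1 => fun x => if φ x = n then p (auxD p T T' φ n (T x), auxD p T T' φ n (T' x))
      else auxD p T T' φ n x

theorem aux_three {X : Type*} [MeasurableSpace X] (T T' : X → X) (hT : Measurable T)
    (hT' : Measurable T') (hTT : ∀ x, T' (T x) = x) (φ : X → ℕ) (hφ : Measurable φ)
    (hne : ∀ x, φ x ≠ φ (T x)) :
    ∃ c : X → Fin 3, Measurable c ∧ ∀ x, c x ≠ c (T x) := by
  obtain ⟨p, hp⟩ := aux_pick
  have hm : ∀ n, Measurable (auxD p T T' φ n) := by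
    intro n
    induction n with
    | zero => exact measurable_const
    | succ n ih =>
      unfold auxD
      refine Measurable.ite (hφ (measurableSet_singleton n)) ?_ ih
      exact (Measurable.of_discrete (f := p)).comp ((ih.comp hT).prodMk (ih.comp hT'))
  have hst : ∀ x m, φ x < m → auxD p T T' φ m x = auxD p T T' φ (φ x + 1) x := by
    intro x m hxm
    induction m, hxm using Nat.le_induction with
    | base => rfl
    | succ m hm ih =>
      rw [← ih]
      have : φ x ≠ m := by omega
      simp [auxD, this]
  have hat : ∀ x, auxD p T T' φ (φ x + 1) x =
      p (auxD p T T' φ (φ x) (T x), auxD p T T' φ (φ x) (T' x)) := by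
    intro x
    simp [auxD]
  refine ⟨fun x => auxD p T T' φ (φ x + 1) x,
    aux_diag (fun n => auxD p T T' φ (n + 1)) (fun n => hm _) φ hφ, ?_⟩
  intro x
  show auxD p T T' φ (φ x + 1) x ≠ auxD p T T' φ (φ (T x) + 1) (T x)
  rcases lt_or_gt_of_ne (hne x) with h | h
  · rw [hat (T x), hTT, ← hst x _ h]
    exact (hp _ _).2.symm
  · rw [hat x, ← hst (T x) _ h]
    exact (hp _ _).1

theorem aux_shift_mul {G : Type*} [Group G] (g h : G) (x : G → Bool) :
    shiftMap g (shiftMap h x) = shiftMap (g * h) x := by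
  funext k
  simp [shiftMap, mul_assoc]

theorem aux_shift_one {G : Type*} [Group G] (x : G → Bool) :
    shiftMap 1 x = x := by
  funext k
  simp [shiftMap]

theorem aux_free {G : Type*} [Group G] (g : G) (x : G → Bool) (hx : x ∈ FreePart G) :
    shiftMap g x ∈ FreePart G := by
  intro k hk he
  apply hx (g⁻¹ * k * g) (by
    intro h
    apply hk
    have : k = g * (g⁻¹ * k * g) * g⁻¹ := by group
    rw [this, h]; group)
  have := congrArg (shiftMap g⁻¹) he
  simpa [aux_shift_mul, aux_shift_one, mul_assoc] using this

theorem aux_shift_meas {G : Type*} [Group G] (g : G) :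
    Measurable (shiftMap g : (G → Bool) → (G → Bool)) :=
  measurable_pi_lambda _ fun h => measurable_pi_apply (g⁻¹ * h)

theorem aux_shift_cont {G : Type*} [Group G] (g : G) :
    Continuous (shiftMap g : (G → Bool) → (G → Bool)) :=
  continuous_pi fun h => continuous_apply (g⁻¹ * h)

/-- The shift on the free part. -/
def auxT {G : Type*} [Group G] (g : G) (x : FreePart G) : FreePart G :=
  ⟨shiftMap g x.1, aux_free g x.1 x.2⟩

theorem auxT_meas {G : Type*} [Group G] (g : G) : Measurable (auxT g) :=
  ((aux_shift_meas g).comp measurable_subtype_coe).subtype_mk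

theorem aux_three_shift {G : Type*} [Group G] [Countable G] (s : G) (hs : s ≠ 1) :
    ∃ c : FreePart G → Fin 3, Measurable c ∧ ∀ x, c x ≠ c (auxT s x) := by
  classical
  obtain ⟨e, he⟩ := exists_surjective_nat G
  have hex : ∀ x : FreePart G, ∃ n, x.1 (s⁻¹ * e n) ≠ x.1 (e n) := by
    intro x
    by_contra! hcon
    apply x.2 s hs
    funext h
    obtain ⟨n, rfl⟩ := he h
    exact hcon n
  have hev : ∀ g : G, Measurable (fun x : FreePart G => x.1 g) := fun g =>
    (measurable_pi_apply g).comp measurable_subtype_coe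
  have hN : Measurable (fun x : FreePart G => Nat.find (hex x)) := by
    refine measurable_find hex fun k => ?_
    exact (measurableSet_eq_fun (hev _) (hev _)).compl
  have hB : Measurable (fun x : FreePart G => x.1 (e (Nat.find (hex x)))) :=
    aux_diag (fun n (x : FreePart G) => x.1 (e n)) (fun n => hev _) _ hN
  refine aux_three (auxT s) (auxT s⁻¹) (auxT_meas s) (auxT_meas s⁻¹) ?_
    (fun x => 2 * Nat.find (hex x) + (x.1 (e (Nat.find (hex x)))).toNat) ?_ ?_
  · intro x
    apply Subtype.ext
    simp [auxT, aux_shift_mul, aux_shift_one]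
  · exact (measurable_const.mul hN).add ((Measurable.of_discrete (f := Bool.toNat)).comp hB)
  · intro x hx
    have h1 := Bool.toNat_le (x.1 (e (Nat.find (hex x))))
    have h2 := Bool.toNat_le ((auxT s x).1 (e (Nat.find (hex (auxT s x)))))
    have h3 : Nat.find (hex x) = Nat.find (hex (auxT s x)) := by omega
    have h4 : (x.1 (e (Nat.find (hex x)))).toNat =
      ((auxT s x).1 (e (Nat.find (hex x)))).toNat := by
      rw [← h3] at hx; omega
    have h5 : x.1 (e (Nat.find (hex x))) = (auxT s x).1 (e (Nat.find (hex x))) := by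
      revert h4
      generalize x.1 (e (Nat.find (hex x))) = a
      generalize (auxT s x).1 (e (Nat.find (hex x))) = b
      revert a b
      decide
    exact Nat.find_spec (hex x) h5.symm

theorem aux_finite_coloring {G : Type*} [Group G] (S : Set G) (hS : IsMarkedGroup S) :
    ∃ n, HasBorelColoring (ShiftAdj S) n := by
  classical
  obtain ⟨hf, -, h1, hc⟩ := hS
  have := aux_countable S hf hc
  have : Fintype S := hf.fintype
  have hall : ∀ s : S, ∃ c : FreePart G → Fin 3, Measurable c ∧ ∀ x, c x ≠ c (auxT s.1 x) :=
    fun s => aux_three_shift s.1 (fun h => h1 (h ▸ s.2))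
  choose c hcm hcn using hall
  refine ⟨Fintype.card (S → Fin 3), fun x => Fintype.equivFin (S → Fin 3) (fun s => c s x), ?_, ?_⟩
  · exact (Measurable.of_discrete (f := Fintype.equivFin (S → Fin 3))).comp
      (measurable_pi_lambda _ fun s => hcm s)
  · rintro x y ⟨-, s, hs, hy⟩ he
    have h2 := congrFun ((Fintype.equivFin (S → Fin 3)).injective he) ⟨s, hs⟩
    have h3 : y = auxT s x := Subtype.ext hy
    rw [h3] at h2
    exact hcn ⟨s, hs⟩ x h2

theorem aux_cyl {G : Type*} (U : Set (G → Bool)) (hU : IsOpen U) (x : G → Bool) (hx : x ∈ U) :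
    ∃ K : Finset G, ∀ y : G → Bool, (∀ k ∈ K, y k = x k) → y ∈ U := by
  obtain ⟨K, u, h1, h2⟩ := isOpen_pi_iff.1 hU x hx
  refine ⟨K, fun y hy => h2 ?_⟩
  intro k hk
  rw [hy k hk]
  exact (h1 k hk).2

theorem aux_mix {G : Type*} [Group G] (T : Set G) (hT : T.Infinite) (U V : Set (G → Bool))
    (hU : IsOpen U) (hV : IsOpen V) (hUn : U.Nonempty) (hVn : V.Nonempty) :
    ∃ h ∈ T, ∃ x ∈ U, shiftMap h x ∈ V := by
  classical
  obtain ⟨x0, hx0⟩ := hUn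
  obtain ⟨y0, hy0⟩ := hVn
  obtain ⟨K, hK⟩ := aux_cyl U hU x0 hx0
  obtain ⟨L, hL⟩ := aux_cyl V hV y0 hy0
  obtain ⟨h, hhT, hh⟩ := hT.exists_notMem_finset ((L ×ˢ K).image fun q => q.1 * q.2⁻¹)
  refine ⟨h, hhT, fun g => if g ∈ K then x0 g else y0 (h * g), hK _ ?_, hL _ ?_⟩
  · intro k hk
    simp [hk]
  · intro l hl
    have : h⁻¹ * l ∉ K := by
      intro hk
      apply hh
      rw [Finset.mem_image]
      exact ⟨(l, h⁻¹ * l), Finset.mem_product.2 ⟨hl, hk⟩, by simp⟩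
    simp [shiftMap, this]

theorem aux_free_residual {G : Type*} [Group G] [Infinite G] [Countable G] :
    FreePart G ∈ residual (G → Bool) := by
  classical
  have : FreePart G = ⋂ g : G, {x | g ≠ 1 → shiftMap g x ≠ x} := by
    ext x
    simp [FreePart]
  rw [this]
  refine countable_iInter_mem.2 fun g => ?_
  by_cases hg : g = 1
  · simp [hg]
  refine residual_of_dense_open ?_ ?_
  · simp only [ne_eq, hg, not_false_eq_true, forall_const]
    exact (isClosed_eq (aux_shift_cont g) continuous_id).isOpen_compl
  · rw [dense_iff_inter_open]
    rintro U hU ⟨x, hx⟩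
    obtain ⟨K, hK⟩ := aux_cyl U hU x hx
    obtain ⟨h, hh⟩ := Infinite.exists_notMem_finset K
    refine ⟨Function.update x h (!(x (g⁻¹ * h))), hK _ ?_, ?_⟩
    · intro k hk
      rw [Function.update_of_ne]
      rintro rfl
      exact hh hk
    · intro _ he
      have h1 := congrFun he h
      have h2 : g⁻¹ * h ≠ h := by simpa using hg
      simp [shiftMap, Function.update_of_ne h2] at h1

theorem aux_shift_tendsto {G : Type*} [Group G] (g : G) :
    Filter.Tendsto (shiftMap g) (residual (G → Bool)) (residual (G → Bool)) := by
  let e : (G → Bool) ≃ₜ (G → Bool) :=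
    { toFun := shiftMap g
      invFun := shiftMap g⁻¹
      left_inv := fun x => by simp [aux_shift_mul, aux_shift_one]
      right_inv := fun x => by simp [aux_shift_mul, aux_shift_one]
      continuous_toFun := aux_shift_cont g
      continuous_invFun := aux_shift_cont g⁻¹ }
  exact tendsto_residual_of_isOpenMap e.continuous e.isOpenMap

theorem aux_no_two {G : Type*} [Group G] [Infinite G] (S : Set G) (hS : IsMarkedGroup S) :
    ¬ ∃ c : FreePart G → Fin 2, Measurable c ∧ ∀ x y, ShiftAdj S x y → c x ≠ c y := by
  classical
  rintro ⟨c, hcm, hc⟩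
  obtain ⟨hf, -, h1, hcl⟩ := hS
  have := aux_countable S hf hcl
  have hflip : ∀ s ∈ S, ∀ x, c (auxT s x) ≠ c x := by
    intro s hs x
    refine (hc x (auxT s x) ⟨?_, s, hs, rfl⟩).symm
    intro h
    exact x.2 s (fun h => h1 (h ▸ hs)) (congrArg Subtype.val h).symm
  have hTmul : ∀ g h : G, ∀ x, auxT (g * h) x = auxT g (auxT h x) := fun g h x =>
    Subtype.ext (aux_shift_mul g h x.1).symm
  have hTone : ∀ x : FreePart G, auxT 1 x = x := fun x => Subtype.ext (aux_shift_one x.1)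
  have hPQ : ∀ g : G, (∀ x, c (auxT g x) = c x) ∨ (∀ x, c (auxT g x) ≠ c x) := by
    intro g
    have hg : g ∈ Subgroup.closure S := hcl ▸ Subgroup.mem_top g
    induction hg using Subgroup.closure_induction with
    | mem s hs => exact Or.inr (hflip s hs)
    | one => exact Or.inl fun x => by rw [hTone]
    | mul g h _ _ ihg ihh =>
      simp only [hTmul]
      rcases ihg with ihg | ihg <;> rcases ihh with ihh | ihh
      · exact Or.inl fun x => (ihg _).trans (ihh x)
      · exact Or.inr fun x => by rw [ihg]; exact ihh x
      · exact Or.inr fun x => by rw [← ihh x]; exact ihg _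
      · refine Or.inl fun x => ?_
        have a := ihg (auxT h x)
        have b := ihh x
        omega
    | inv g _ ih =>
      have hx : ∀ x : FreePart G, auxT g (auxT g⁻¹ x) = x := fun x => by
        rw [← hTmul, mul_inv_cancel, hTone]
      rcases ih with ih | ih
      · refine Or.inl fun x => ?_
        have := ih (auxT g⁻¹ x)
        rw [hx] at this
        exact this.symm
      · refine Or.inr fun x => ?_
        have := ih (auxT g⁻¹ x)
        rw [hx] at this
        exact this.symm
  have hSne : ∃ s, s ∈ S := by
    by_contra! hcon
    have : S = ∅ := Set.eq_empty_of_forall_notMem hcon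
    rw [this, Subgroup.closure_empty] at hcl
    have hsub : Subsingleton G := by
      refine ⟨fun a b => ?_⟩
      have ha : a ∈ (⊥ : Subgroup G) := hcl ▸ Subgroup.mem_top a
      have hb : b ∈ (⊥ : Subgroup G) := hcl ▸ Subgroup.mem_top b
      rw [Subgroup.mem_bot] at ha hb
      rw [ha, hb]
    exact not_finite G
  have hF := aux_free_residual (G := G)
  have hFm : MeasurableSet (FreePart G) := by
    have : FreePart G = ⋂ g : G, ⋂ _ : g ≠ 1, {x | shiftMap g x ≠ x} := by
      ext x
      simp [FreePart]
    rw [this]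
    refine MeasurableSet.iInter fun g => MeasurableSet.iInter fun _ => ?_
    exact (isClosed_eq (aux_shift_cont g) continuous_id).isOpen_compl.measurableSet
  have hUex : ∀ i : Fin 2, ∃ U : Set (G → Bool), IsOpen U ∧
      ∀ᶠ x in residual (G → Bool), ∀ hx : x ∈ FreePart G, (c ⟨x, hx⟩ = i ↔ x ∈ U) := by
    intro i
    have hm : MeasurableSet (Subtype.val '' (c ⁻¹' {i})) :=
      hFm.subtype_image (hcm (measurableSet_singleton i))
    obtain ⟨U, hU, he⟩ := hm.residualEq_isOpen
    refine ⟨U, hU, ?_⟩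
    filter_upwards [Filter.eventuallyEq_set.1 he] with x hx hxF
    rw [← hx]
    simp [hxF]
  choose U hUo hU using hUex
  -- a generic point together with its translate
  have key : ∀ (g : G) (W : Set (G → Bool)), IsOpen W → W.Nonempty →
      ∃ x : FreePart G, x.1 ∈ W ∧ (∀ i, c x = i ↔ x.1 ∈ U i) ∧
        (∀ i, c (auxT g x) = i ↔ shiftMap g x.1 ∈ U i) := by
    intro g W hW hWn
    have hU' : ∀ᶠ x in residual (G → Bool), ∀ i, ∀ hx : x ∈ FreePart G,
        (c ⟨x, hx⟩ = i ↔ x ∈ U i) := eventually_countable_forall.2 hU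
    have hres := (hU'.and ((aux_shift_tendsto g).eventually hU')).and hF
    obtain ⟨x, hxW, ⟨ha, hb⟩, hx⟩ := (dense_of_mem_residual hres).inter_open_nonempty W hW hWn
    exact ⟨⟨x, hx⟩, hxW, fun i => ha i hx, fun i => hb i (aux_free g x hx)⟩
  have hUne : ∀ i, (U i).Nonempty := by
    intro i
    by_contra hcon
    rw [Set.not_nonempty_iff_eq_empty] at hcon
    obtain ⟨s, hs⟩ := hSne
    obtain ⟨x, -, ha, hb⟩ := key s Set.univ isOpen_univ Set.univ_nonempty
    have h2 := ha i
    have h3 := hb i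
    rw [hcon] at h2 h3
    simp only [Set.mem_empty_iff_false, iff_false] at h2 h3
    have := hflip s hs x
    omega
  have fin : ∀ (T : Set G), T.Infinite → ∀ i j, ∃ g ∈ T, ∃ x, c x = i ∧ c (auxT g x) = j := by
    intro T hT i j
    obtain ⟨g, hg, x, hx, hgx⟩ := aux_mix T hT (U i) (U j) (hUo i) (hUo j) (hUne i) (hUne j)
    obtain ⟨y, ⟨hy1, hy2⟩, ha, hb⟩ := key g (U i ∩ shiftMap g ⁻¹' U j)
      ((hUo i).inter ((hUo j).preimage (aux_shift_cont g))) ⟨x, hx, hgx⟩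
    exact ⟨g, hg, y, (ha i).2 hy1, (hb j).2 hy2⟩
  have hinf : {g : G | ∀ x, c (auxT g x) = c x}.Infinite ∨
      {g : G | ∀ x, c (auxT g x) ≠ c x}.Infinite := by
    rw [← Set.infinite_union]
    have : {g : G | ∀ x, c (auxT g x) = c x} ∪ {g : G | ∀ x, c (auxT g x) ≠ c x} = Set.univ :=
      Set.eq_univ_of_forall hPQ
    rw [this]
    exact Set.infinite_univ
  rcases hinf with h | h
  · obtain ⟨g, hg, x, hx, hy⟩ := fin _ h 0 1
    have := hg x
    rw [hx, hy] at this
    exact absurd this (by decide)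
  · obtain ⟨g, hg, x, hx, hy⟩ := fin _ h 0 0
    exact hg x (hy.trans hx.symm)

/-- If `(G, S)` is an infinite marked group, then the Borel chromatic
number of the shift graph of `(G, S)` is greater than `2`; that is, there is no Borel map
`c : F(2^G) → Fin 2` assigning distinct values to adjacent vertices of the shift graph. -/
theorem borelChromatic_shift_gt_two {G : Type*} [Group G] [Infinite G]
    (S : Set G) (hS : IsMarkedGroup S) :
    2 < borelChromatic (ShiftAdj S) ∧
    ¬ ∃ c : FreePart G → Fin 2, Measurable c ∧ ∀ x y, ShiftAdj S x y → c x ≠ c y := by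
  have hno := aux_no_two S hS
  refine ⟨?_, hno⟩
  by_contra! hle
  obtain ⟨c, hcm, hc⟩ : HasBorelColoring (ShiftAdj S) (borelChromatic (ShiftAdj S)) :=
    Nat.sInf_mem (aux_finite_coloring S hS)
  refine hno ⟨fun x => Fin.castLE hle (c x), (Measurable.of_discrete (f := Fin.castLE hle)).comp hcm,
    fun x y hxy h => hc x y hxy (Fin.castLE_injective hle h)⟩
end

section
/- Let G be a Borel graph on a standard Borel space X in which every vertex has degree at most d, where d is a finite natural number, and let N be a finite natural number. Then X has a maximal Borel (N,G)-discrete subset: a Borel set A ⊆ X such that any two distinct points of A have graph distance greater than N, and every point of X \ A has graph distance at most N from some point of A. -/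
open MeasureTheory in
/-- Projection of a Borel set with sections of bounded size is Borel. -/
lemma measurableSet_fst_image_of_bounded {X Y : Type*} [MeasurableSpace X]
    [StandardBorelSpace X] [MeasurableSpace Y] [StandardBorelSpace Y] (d : ℕ) :
    ∀ R : Set (X × Y), MeasurableSet R →
      (∀ x, ∃ s : Finset Y, s.card ≤ d ∧ ∀ y, (x, y) ∈ R → y ∈ s) →
      MeasurableSet (Prod.fst '' R) := by
  classical
  obtain ⟨e, he⟩ := exists_measurableEmbedding_real Y
  induction d with
  | zero =>
    intro R _ h
    have : R = ∅ := by
      ext ⟨x, y⟩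
      obtain ⟨s, hs, h2⟩ := h x
      have hs0 : s = ∅ := Finset.card_eq_zero.1 (Nat.le_zero.1 hs)
      simp only [Set.mem_empty_iff_false, iff_false]
      intro hxy
      have := h2 y hxy
      simp [hs0] at this
    simp [this]
  | succ d ih =>
    intro R hR h
    let T : Set (X × (Fin (d + 1) → Y)) :=
      {p | (∀ i j, i < j → e (p.2 i) < e (p.2 j)) ∧ ∀ i, (p.1, p.2 i) ∈ R}
    have hT : MeasurableSet T := by
      have h1 : MeasurableSet
          {p : X × (Fin (d + 1) → Y) | ∀ i j, i < j → e (p.2 i) < e (p.2 j)} := by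
        simp only [Set.setOf_forall]
        refine MeasurableSet.iInter fun i => MeasurableSet.iInter fun j =>
          MeasurableSet.iInter fun _ => ?_
        exact measurableSet_lt
          (he.measurable.comp ((measurable_pi_apply i).comp measurable_snd))
          (he.measurable.comp ((measurable_pi_apply j).comp measurable_snd))
      have h2 : MeasurableSet {p : X × (Fin (d + 1) → Y) | ∀ i, (p.1, p.2 i) ∈ R} := by
        simp only [Set.setOf_forall]
        refine MeasurableSet.iInter fun i => ?_
        exact (measurable_fst.prodMk ((measurable_pi_apply i).comp measurable_snd)) hR
      exact h1.inter h2
    have hrange : ∀ x f, (x, f) ∈ T → ∀ s : Finset Y, s.card ≤ d + 1 →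
        (∀ y, (x, y) ∈ R → y ∈ s) → Set.range f = s := by
      intro x f hf s hs hs2
      have hinj : Function.Injective f := by
        intro i j hij
        rcases lt_trichotomy i j with hlt | heq | hlt
        · exact absurd (hf.1 _ _ hlt) (by simp [hij])
        · exact heq
        · exact absurd (hf.1 _ _ hlt) (by simp [hij])
      have hsub : Finset.univ.image f ⊆ s := by
        intro y hy
        obtain ⟨i, -, rfl⟩ := Finset.mem_image.1 hy
        exact hs2 _ (hf.2 i)
      have := Finset.eq_of_subset_of_card_le hsub
        (by rw [Finset.card_image_of_injective _ hinj]; simpa using hs)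
      rw [← this]; simp
    have hE : MeasurableSet (Prod.fst '' T) := by
      refine hT.image_of_measurable_injOn measurable_fst ?_
      rintro ⟨x, f⟩ hf ⟨x', g⟩ hg (rfl : x = x')
      obtain ⟨s, hs, hs2⟩ := h x
      have hr : Set.range f = Set.range g :=
        (hrange x f hf s hs hs2).trans (hrange x g hg s hs hs2).symm
      have hf' : StrictMono (e ∘ f) := fun i j hij => hf.1 i j hij
      have hg' : StrictMono (e ∘ g) := fun i j hij => hg.1 i j hij
      have : e ∘ f = e ∘ g := by
        rw [← StrictMono.range_inj hf' hg', Set.range_comp, Set.range_comp, hr]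
      have : f = g := he.injective.comp_left this
      rw [this]
    have hR' := ih (R ∩ Prod.fst ⁻¹' (Prod.fst '' T)ᶜ)
      (hR.inter (measurable_fst hE.compl)) (by
        intro x
        by_cases hx : x ∈ Prod.fst '' T
        · refine ⟨∅, by simp, ?_⟩
          rintro y ⟨_, hy⟩
          exact absurd hx hy
        · obtain ⟨s, hs, hs2⟩ := h x
          refine ⟨s.filter fun y => (x, y) ∈ R, ?_, ?_⟩
          · by_contra hc
            push Not at hc
            have hcard : ((s.filter fun y => (x, y) ∈ R).image e).card = d + 1 := by
              rw [Finset.card_image_of_injective _ he.injective]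
              exact le_antisymm ((Finset.card_filter_le _ _).trans hs) hc
            let o := ((s.filter fun y => (x, y) ∈ R).image e).orderEmbOfFin hcard
            have ho : ∀ i, ∃ y, (x, y) ∈ R ∧ e y = o i := by
              intro i
              have := Finset.orderEmbOfFin_mem _ hcard i
              obtain ⟨y, hy, hy2⟩ := Finset.mem_image.1 this
              exact ⟨y, (Finset.mem_filter.1 hy).2, hy2⟩
            choose f hf1 hf2 using ho
            refine hx ⟨(x, f), ⟨?_, hf1⟩, rfl⟩
            intro i j hij
            simp only [hf2]
            exact o.strictMono hij
          · rintro y ⟨hy, _⟩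
            exact Finset.mem_filter.2 ⟨hs2 y hy, hy⟩)
    have : Prod.fst '' R =
        Prod.fst '' T ∪ Prod.fst '' (R ∩ Prod.fst ⁻¹' (Prod.fst '' T)ᶜ) := by
      ext x
      constructor
      · rintro ⟨p, hp, rfl⟩
        by_cases hx : p.1 ∈ Prod.fst '' T
        · exact Or.inl hx
        · exact Or.inr ⟨p, ⟨hp, hx⟩, rfl⟩
      · rintro (⟨p, hp, rfl⟩ | ⟨p, hp, rfl⟩)
        · exact ⟨(p.1, p.2 0), hp.2 0, rfl⟩
        · exact ⟨p, hp.1, rfl⟩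
    rw [this]
    exact hE.union hR'

open MeasureTheory in
/-- A Borel symmetric irreflexive relation with bounded sections has a Borel maximal
independent set. -/
lemma exists_maximal_borel_independent {X : Type*} [MeasurableSpace X]
    [StandardBorelSpace X] (H : X → X → Prop) (hsymm : ∀ x y, H x y → H y x)
    (hirr : ∀ x, ¬ H x x) (hH : MeasurableSet {p : X × X | H p.1 p.2}) (d : ℕ)
    (hd : ∀ x, ∃ s : Finset X, s.card ≤ d ∧ ∀ y, H x y → y ∈ s) :
    ∃ A : Set X, MeasurableSet A ∧ (∀ x ∈ A, ∀ y ∈ A, ¬ H x y) ∧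
      ∀ x ∉ A, ∃ y ∈ A, H x y := by
  have hN : ∀ S : Set X, MeasurableSet S → MeasurableSet {x | ∃ y ∈ S, H x y} := by
    intro S hS
    have := measurableSet_fst_image_of_bounded d
      ({p : X × X | H p.1 p.2} ∩ Prod.snd ⁻¹' S) (hH.inter (measurable_snd hS)) (by
        intro x
        obtain ⟨s, hs, h2⟩ := hd x
        exact ⟨s, hs, fun y hy => h2 y hy.1⟩)
    convert this using 1
    ext x
    constructor
    · rintro ⟨y, hy, hxy⟩
      exact ⟨(x, y), ⟨hxy, hy⟩, rfl⟩
    · rintro ⟨p, ⟨h1, h2⟩, rfl⟩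
      exact ⟨p.2, h2, h1⟩
  obtain ⟨e, he⟩ := exists_measurableEmbedding_real X
  obtain ⟨q, hq⟩ := exists_surjective_nat (ℚ × ℚ)
  let U : ℕ → Set X := fun n => e ⁻¹' Set.Ioo ((q n).1 : ℝ) ((q n).2 : ℝ)
  have hU : ∀ n, MeasurableSet (U n) := fun n => he.measurable measurableSet_Ioo
  let B : ℕ → Set X := fun n => U n \ {x | ∃ y ∈ U n, H x y}
  have hB : ∀ n, MeasurableSet (B n) := fun n => (hU n).diff (hN _ (hU n))
  have hBcov : ∀ x, ∃ n, x ∈ B n := by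
    intro x
    obtain ⟨s, -, hs⟩ := hd x
    have hfin : (e '' {y | H x y}).Finite :=
      (s.finite_toSet.subset fun y hy => hs y hy).image e
    have hx : e x ∈ (e '' {y | H x y})ᶜ := by
      rintro ⟨y, hy, hxy⟩
      rw [he.injective hxy] at hy
      exact hirr x hy
    obtain ⟨v, hv, hxv, hsub⟩ :=
      Real.isTopologicalBasis_Ioo_rat.exists_subset_of_mem_open hx hfin.isClosed.isOpen_compl
    simp only [Set.mem_iUnion, Set.mem_singleton_iff] at hv
    obtain ⟨a, b, hab, rfl⟩ := hv
    obtain ⟨n, hn⟩ := hq (a, b)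
    refine ⟨n, ?_, ?_⟩
    · simpa [U, hn] using hxv
    · rintro ⟨y, hy, hxy⟩
      have : e y ∈ Set.Ioo (a : ℝ) b := by simpa [U, hn] using hy
      exact hsub this ⟨y, hxy, rfl⟩
  let A : ℕ → Set X := fun n =>
    Nat.rec ∅ (fun n S => S ∪ (B n \ {x | ∃ y ∈ S, H x y})) n
  have hA : ∀ n, A (n + 1) = A n ∪ (B n \ {x | ∃ y ∈ A n, H x y}) := fun n => rfl
  have hAm : ∀ n, MeasurableSet (A n) := by
    intro n
    induction n with
    | zero => exact MeasurableSet.empty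
    | succ n ih => rw [hA]; exact ih.union ((hB n).diff (hN _ ih))
  have hmono : Monotone A := monotone_nat_of_le_succ fun n => by
    rw [hA]; exact Set.subset_union_left
  have hind : ∀ n, ∀ x ∈ A n, ∀ y ∈ A n, ¬ H x y := by
    intro n
    induction n with
    | zero => intro x hx; exact absurd hx (Set.notMem_empty x)
    | succ n ih =>
      rw [hA]
      rintro x (hx | hx) y (hy | hy) hxy
      · exact ih x hx y hy hxy
      · exact hy.2 ⟨x, hx, hsymm _ _ hxy⟩
      · exact hx.2 ⟨y, hy, hxy⟩
      · exact hx.1.2 ⟨y, hy.1.1, hxy⟩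
  refine ⟨⋃ n, A n, MeasurableSet.iUnion hAm, ?_, ?_⟩
  · intro x hx y hy
    obtain ⟨n, hx⟩ := Set.mem_iUnion.1 hx
    obtain ⟨m, hy⟩ := Set.mem_iUnion.1 hy
    exact hind (max n m) x (hmono (le_max_left _ _) hx) y (hmono (le_max_right _ _) hy)
  · intro x hx
    obtain ⟨n, hn⟩ := hBcov x
    by_contra hc
    refine hx (Set.mem_iUnion.2 ⟨n + 1, ?_⟩)
    rw [hA]
    refine Or.inr ⟨hn, ?_⟩
    rintro ⟨y, hy, hxy⟩
    exact hc ⟨y, Set.mem_iUnion.2 ⟨n, hy⟩, hxy⟩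

lemma walk_le_succ_iff {X : Type*} (G : SimpleGraph X) (n : ℕ) (x y : X) :
    (∃ w : G.Walk x y, w.length ≤ n + 1) ↔
      x = y ∨ ∃ z, G.Adj x z ∧ ∃ w : G.Walk z y, w.length ≤ n := by
  constructor
  · rintro ⟨w, hw⟩
    cases w with
    | nil => exact Or.inl rfl
    | cons h p => exact Or.inr ⟨_, h, p, by simpa using hw⟩
  · rintro (rfl | ⟨z, h, p, hp⟩)
    · exact ⟨SimpleGraph.Walk.nil, by simp⟩
    · exact ⟨SimpleGraph.Walk.cons h p, by simpa using hp⟩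

lemma walk_le_measurable_bounded {X : Type*} [MeasurableSpace X]
    [StandardBorelSpace X] (G : SimpleGraph X)
    (hG : MeasurableSet {p : X × X | G.Adj p.1 p.2})
    (d : ℕ) (hd : ∀ x, ∃ s : Finset X, s.card ≤ d ∧ ∀ y, G.Adj x y → y ∈ s) (n : ℕ) :
    MeasurableSet {p : X × X | ∃ w : G.Walk p.1 p.2, w.length ≤ n} ∧
    ∃ k : ℕ, ∀ x, ∃ s : Finset X, s.card ≤ k ∧
      ∀ y, (∃ w : G.Walk x y, w.length ≤ n) → y ∈ s := by
  classical
  induction n with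
  | zero =>
    have h0 : ∀ x y, (∃ w : G.Walk x y, w.length ≤ 0) → x = y := by
      rintro x y ⟨w, hw⟩
      exact SimpleGraph.Walk.eq_of_length_eq_zero (Nat.le_zero.1 hw)
    constructor
    · have : {p : X × X | ∃ w : G.Walk p.1 p.2, w.length ≤ 0} = {p | p.1 = p.2} := by
        ext ⟨x, y⟩
        refine ⟨h0 x y, ?_⟩
        rintro (rfl : x = y)
        exact ⟨SimpleGraph.Walk.nil, by simp⟩
      rw [this]
      exact measurableSet_eq_fun measurable_fst measurable_snd
    · exact ⟨1, fun x => ⟨{x}, by simp, fun y hy => by simp [h0 x y hy]⟩⟩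
  | succ n ih =>
    obtain ⟨hm, k, hk⟩ := ih
    simp only [walk_le_succ_iff]
    constructor
    · have hT : MeasurableSet {p : (X × X) × X | G.Adj p.1.1 p.2 ∧
          ∃ w : G.Walk p.2 p.1.2, w.length ≤ n} := by
        refine MeasurableSet.inter ?_ ?_
        · exact ((measurable_fst.comp measurable_fst).prodMk measurable_snd) hG
        · exact (measurable_snd.prodMk (measurable_snd.comp measurable_fst)) hm
      have h2 := measurableSet_fst_image_of_bounded d _ hT (by
        rintro ⟨x, y⟩
        obtain ⟨s, hs, h⟩ := hd x
        exact ⟨s, hs, fun z hz => h z hz.1⟩)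
      have : {p : X × X | p.1 = p.2 ∨ ∃ z, G.Adj p.1 z ∧ ∃ w : G.Walk z p.2, w.length ≤ n} =
          {p | p.1 = p.2} ∪ Prod.fst '' {p : (X × X) × X | G.Adj p.1.1 p.2 ∧
          ∃ w : G.Walk p.2 p.1.2, w.length ≤ n} := by
        ext p
        constructor
        · rintro (h | ⟨z, hz⟩)
          · exact Or.inl h
          · exact Or.inr ⟨(p, z), hz, rfl⟩
        · rintro (h | ⟨q, hq, rfl⟩)
          · exact Or.inl h
          · exact Or.inr ⟨q.2, hq⟩
      rw [this]
      exact (measurableSet_eq_fun measurable_fst measurable_snd).union h2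
    · choose t ht1 ht2 using hk
      refine ⟨d * k + 1, fun x => ?_⟩
      obtain ⟨s, hs, h⟩ := hd x
      refine ⟨insert x (s.biUnion t), ?_, ?_⟩
      · refine (Finset.card_insert_le _ _).trans (Nat.succ_le_succ ?_)
        exact (Finset.card_biUnion_le_card_mul s t k fun z _ => ht1 z).trans
          (Nat.mul_le_mul_right k hs)
      · rintro y (rfl | ⟨z, hz, hw⟩)
        · exact Finset.mem_insert_self _ _
        · exact Finset.mem_insert_of_mem (Finset.mem_biUnion.2 ⟨z, h z hz, ht2 z y hw⟩)

/-- Let `G` be a Borel graph on a standard Borel space `X` in which every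
vertex has degree at most `d < ℵ₀`, and let `N < ℵ₀`. Then `X` has a maximal Borel
`(N, G)`-discrete subset: a Borel set `A ⊆ X` such that any two distinct points of `A`
have graph distance greater than `N` (no path of length `≤ N` joins them), and every
point of `X \ A` has graph distance at most `N` from some point of `A`. -/
theorem exists_maximal_borel_discrete_set {X : Type*} [MeasurableSpace X]
    [StandardBorelSpace X] (G : SimpleGraph X)
    (hG : MeasurableSet {p : X × X | G.Adj p.1 p.2})
    (d : ℕ) (hdeg : ∀ x : X, (G.neighborSet x).Finite ∧ (G.neighborSet x).ncard ≤ d)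
    (N : ℕ) :
    ∃ A : Set X, MeasurableSet A ∧
      (∀ x ∈ A, ∀ y ∈ A, x ≠ y → ∀ w : G.Walk x y, N < w.length) ∧
      (∀ x ∉ A, ∃ y ∈ A, ∃ w : G.Walk x y, w.length ≤ N) := by
  have hd : ∀ x, ∃ s : Finset X, s.card ≤ d ∧ ∀ y, G.Adj x y → y ∈ s := by
    intro x
    obtain ⟨hf, hc⟩ := hdeg x
    refine ⟨hf.toFinset, ?_, fun y hy => by simpa using hy⟩
    rwa [← Set.ncard_eq_toFinset_card _ hf]
  obtain ⟨hm, k, hk⟩ := walk_le_measurable_bounded G hG d hd N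
  obtain ⟨A, hA, h1, h2⟩ := exists_maximal_borel_independent
    (fun x y => x ≠ y ∧ ∃ w : G.Walk x y, w.length ≤ N)
    (by
      rintro x y ⟨hne, w, hw⟩
      exact ⟨hne.symm, w.reverse, by simpa using hw⟩)
    (fun x h => h.1 rfl)
    ((measurableSet_eq_fun measurable_fst measurable_snd).compl.inter hm) k
    (by
      intro x
      obtain ⟨s, hs, h⟩ := hk x
      exact ⟨s, hs, fun y hy => h y hy.2⟩)
  refine ⟨A, hA, ?_, ?_⟩
  · intro x hx y hy hne w
    by_contra hc
    exact h1 x hx y hy ⟨hne, w, not_lt.1 hc⟩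
  · intro x hx
    obtain ⟨y, hy, -, hw⟩ := h2 x hx
    exact ⟨y, hy, hw⟩
end

section
/- Let Δ = (ℤ/3ℤ) ⋊_φ ℤ, where φ : ℤ → Aut(ℤ/3ℤ) sends 1 to the inversion automorphism i ↦ -i, with generating set S = {(1,0),(2,0),(0,1),(0,-1)}. Then the Borel chromatic number of the shift graph of (Δ,S) equals 4. -/
open Multiplicative

/-- The homomorphism `ℤ → Aut(ℤ/3ℤ)` (written multiplicatively) sending `1` to the
inversion automorphism `i ↦ -i`. -/
def phi3 : Multiplicative ℤ →* MulAut (Multiplicative (ZMod 3)) :=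
  zpowersHom (MulAut (Multiplicative (ZMod 3))) (MulEquiv.inv (Multiplicative (ZMod 3)))

/-- The marked group `Δ = ℤ/3ℤ ⋊_φ ℤ`, `φ` sending `1` to inversion. -/
abbrev Delta3 : Type := SemidirectProduct (Multiplicative (ZMod 3)) (Multiplicative ℤ) phi3

/-- The generating set `S = {(1,0), (2,0), (0,1), (0,-1)}` of `Δ`. -/
def T3 : Set Delta3 :=
  {⟨ofAdd (1 : ZMod 3), ofAdd (0 : ℤ)⟩, ⟨ofAdd (2 : ZMod 3), ofAdd (0 : ℤ)⟩,
   ⟨ofAdd (0 : ZMod 3), ofAdd (1 : ℤ)⟩, ⟨ofAdd (0 : ZMod 3), ofAdd (-1 : ℤ)⟩}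


namespace D3

theorem marker {X ι : Type*} [TopologicalSpace X] [T1Space X] [SecondCountableTopology X]
    [MeasurableSpace X] [BorelSpace X] [Finite ι] (f : ι → X → X) (hf : ∀ i, Measurable (f i))
    (hsym : ∀ i, ∃ j, ∀ x, f j (f i x) = x) (hne : ∀ i x, f i x ≠ x) :
    ∃ M : Set X, MeasurableSet M ∧ (∀ x ∈ M, ∀ i, f i x ∉ M) ∧ ∀ x, x ∈ M ∨ ∃ i, f i x ∈ M := by
  obtain ⟨b, hbc, -, hb⟩ := TopologicalSpace.exists_countable_basis X
  rcases isEmpty_or_nonempty X with hX | hX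
  · exact ⟨∅, MeasurableSet.empty, by simp, fun x => hX.elim x⟩
  have hbne : b.Nonempty := by
    obtain ⟨u, hu, -⟩ := hb.exists_subset_of_mem_open (Set.mem_univ (Classical.arbitrary X)) isOpen_univ
    exact ⟨u, hu⟩
  obtain ⟨U, rfl⟩ := hbc.exists_eq_range hbne
  have hUm : ∀ k, MeasurableSet (U k) := fun k => (hb.isOpen ⟨k, rfl⟩).measurableSet
  let W : ℕ → Set X := fun k => {x | x ∈ U k ∧ ∀ i, f i x ∉ U k}
  have hWm : ∀ k, MeasurableSet (W k) := by
    intro k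
    have : W k = U k ∩ ⋂ i, (f i ⁻¹' (U k))ᶜ := by ext x; simp [W]
    rw [this]
    exact (hUm k).inter (MeasurableSet.iInter fun i => ((hf i) (hUm k)).compl)
  have hW : ∀ x, ∃ k, x ∈ W k := by
    intro x
    have hO : IsOpen (Set.range (fun i => f i x))ᶜ := (Set.finite_range _).isClosed.isOpen_compl
    obtain ⟨u, ⟨k, rfl⟩, hx, hu⟩ := hb.exists_subset_of_mem_open
      (show x ∈ (Set.range (fun i => f i x))ᶜ by
        rintro ⟨i, hi⟩; exact hne i x hi) hO
    exact ⟨k, hx, fun i hi => hu hi ⟨i, rfl⟩⟩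
  let A : ℕ → Set X := fun k => Nat.rec ∅ (fun k S => S ∪ {x | x ∈ W k ∧ ∀ i, f i x ∉ S}) k
  have hA : ∀ k, A (k+1) = A k ∪ {x | x ∈ W k ∧ ∀ i, f i x ∉ A k} := fun k => rfl
  have hAm : ∀ k, MeasurableSet (A k) := by
    intro k
    induction k with
    | zero => exact MeasurableSet.empty
    | succ k ih =>
      have : A (k+1) = A k ∪ (W k ∩ ⋂ i, (f i ⁻¹' (A k))ᶜ) := by rw [hA]; ext x; simp
      rw [this]
      exact ih.union ((hWm k).inter (MeasurableSet.iInter fun i => ((hf i) ih).compl))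
  have hmono : Monotone A := monotone_nat_of_le_succ fun k => by
    rw [hA]; exact Set.subset_union_left
  have hind : ∀ k, ∀ x ∈ A k, ∀ i, f i x ∉ A k := by
    intro k
    induction k with
    | zero => intro x hx; exact hx.elim
    | succ k ih =>
      rw [hA]
      rintro x (hx | hx) i (hi | hi)
      · exact ih x hx i hi
      · obtain ⟨j, hj⟩ := hsym i
        apply hi.2 j
        rw [hj]; exact hx
      · exact hx.2 i hi
      · exact hx.1.2 i hi.1.1
  refine ⟨⋃ k, A k, MeasurableSet.iUnion hAm, ?_, ?_⟩
  · intro x hx i hi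
    obtain ⟨k, hk⟩ := Set.mem_iUnion.1 hx
    obtain ⟨l, hl⟩ := Set.mem_iUnion.1 hi
    exact hind (max k l) x (hmono (le_max_left _ _) hk) i (hmono (le_max_right _ _) hl)
  · intro x
    obtain ⟨k, hk⟩ := hW x
    rcases Classical.em (∃ i, f i x ∈ A k) with h | h
    · obtain ⟨i, hi⟩ := h
      exact Or.inr ⟨i, Set.mem_iUnion.2 ⟨k, hi⟩⟩
    · left
      refine Set.mem_iUnion.2 ⟨k+1, ?_⟩
      rw [hA]
      right
      exact ⟨hk, fun i hi => h ⟨i, hi⟩⟩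

theorem shift_mul {G : Type*} [Group G] (g h : G) (x : G → Bool) :
    shiftMap g (shiftMap h x) = shiftMap (g * h) x := by
  funext k; simp [shiftMap, mul_assoc]

theorem shift_one {G : Type*} [Group G] (x : G → Bool) : shiftMap 1 x = x := by
  funext k; simp [shiftMap]

theorem shift_mem {G : Type*} [Group G] (g : G) {x : G → Bool} (hx : x ∈ FreePart G) :
    shiftMap g x ∈ FreePart G := by
  intro h hh e
  apply hx (g⁻¹ * h * g)
  · intro h1
    apply hh
    have : h = g * (g⁻¹ * h * g) * g⁻¹ := by group
    rw [this, h1]; simp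
  · have := congrArg (shiftMap g⁻¹) e
    simpa [shift_mul, shift_one, mul_assoc] using this

def act {G : Type*} [Group G] (g : G) (x : FreePart G) : FreePart G := ⟨shiftMap g x.1, shift_mem g x.2⟩

theorem act_act {G : Type*} [Group G] (g h : G) (x : FreePart G) : act g (act h x) = act (g * h) x :=
  Subtype.ext (shift_mul g h x.1)

theorem act_one {G : Type*} [Group G] (x : FreePart G) : act 1 x = x :=
  Subtype.ext (shift_one x.1)

theorem act_ne {G : Type*} [Group G] {g : G} (hg : g ≠ 1) (x : FreePart G) : act g x ≠ x :=
  fun h => x.2 g hg (congrArg Subtype.val h)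

theorem shift_cont {G : Type*} [Group G] (g : G) : Continuous (shiftMap g : (G → Bool) → G → Bool) := by
  unfold shiftMap; fun_prop

theorem shift_meas {G : Type*} [Group G] (g : G) : Measurable (shiftMap g : (G → Bool) → G → Bool) := by
  unfold shiftMap; fun_prop

theorem act_meas {G : Type*} [Group G] (g : G) : Measurable (act g : FreePart G → FreePart G) :=
  ((shift_meas g).comp measurable_subtype_coe).subtype_mk

def a : Delta3 := ⟨ofAdd (1 : ZMod 3), ofAdd (0 : ℤ)⟩
def t : Delta3 := ⟨ofAdd (0 : ZMod 3), ofAdd (1 : ℤ)⟩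
theorem aaa : a * (a * a) = 1 := by
  apply SemidirectProduct.ext
  · simp [a]; decide
  · simp [a]
theorem ta : t * a = a * (a * t) := by
  apply SemidirectProduct.ext
  · simp [a, t, phi3]; decide
  · simp [a, t]
theorem a2 : (⟨ofAdd (2 : ZMod 3), ofAdd (0 : ℤ)⟩ : Delta3) = a * a := by
  apply SemidirectProduct.ext
  · simp [a]; decide
  · simp [a]
theorem tinv : (⟨ofAdd (0 : ZMod 3), ofAdd (-1 : ℤ)⟩ : Delta3) = t⁻¹ := by
  apply SemidirectProduct.ext
  · simp [t]
  · simp [t]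
theorem a_ne : a ≠ 1 := by
  intro h; have := congrArg SemidirectProduct.left h; revert this; simp [a]
theorem t_right : t.right = ofAdd 1 := rfl
theorem a_right : a.right = 1 := rfl

theorem dec (g : Delta3) : g = t ^ (toAdd g.right) ∨ g = a * t ^ (toAdd g.right) ∨
    g = a * (a * t ^ (toAdd g.right)) := by
  have ht : ∀ n : ℤ, t ^ n = SemidirectProduct.inr (ofAdd n) := by
    intro n
    have : t = SemidirectProduct.inr (ofAdd 1) := rfl
    rw [this, ← map_zpow]; congr 1; simp [← ofAdd_zsmul]
  rw [ht]
  obtain ⟨l, r⟩ := g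
  have : ∀ l : Multiplicative (ZMod 3), l = 1 ∨ l = ofAdd 1 ∨ l = ofAdd 1 * ofAdd 1 := by decide
  rcases this l with rfl | rfl | rfl
  · left; apply SemidirectProduct.ext <;> simp
  · right; left; apply SemidirectProduct.ext <;> simp [a]
  · right; right; apply SemidirectProduct.ext <;> simp [a]

instance : Countable Delta3 := by
  have : Function.Injective (fun g : Delta3 => (g.left, g.right)) := by
    intro g h e
    simp only [Prod.mk.injEq] at e
    exact SemidirectProduct.ext e.1 e.2
  have h1 : Countable (Multiplicative (ZMod 3)) := inferInstanceAs (Countable (ZMod 3))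
  have h2 : Countable (Multiplicative ℤ) := inferInstanceAs (Countable ℤ)
  exact this.countable

instance : Infinite Delta3 :=
  Infinite.of_injective (fun n : ℤ => (⟨1, ofAdd n⟩ : Delta3)) (fun m n h => by
    simpa using congrArg SemidirectProduct.right h)

end D3

namespace D3

def sc (i : Fin 4) : Fin 4 := if i = 0 then 1 else if i = 1 then 2 else 0

def rr (q : Fin 4 × Fin 4 × Fin 4 × Fin 4 × Fin 4 × Fin 4) : Fin 4 :=
  let (p0, p1, p2, q0, q1, q2) := q
  if p0 = q0 ∧ p1 = q1 then p1
  else if q0 ≠ p0 ∧ q1 ≠ p1 ∧ q2 ≠ p2 then (if q0 = p1 then p2 else p1)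
  else if p2 = q2 then 3 else p1

def Tri (p0 p1 p2 : Fin 4) : Prop :=
  p0 ≠ 3 ∧ p1 ≠ 3 ∧ p2 ≠ 3 ∧ p0 ≠ p1 ∧ p1 ≠ p2 ∧ p0 ≠ p2

instance (p0 p1 p2 : Fin 4) : Decidable (Tri p0 p1 p2) := by unfold Tri; infer_instance

theorem tri_sc : ∀ p0 p1 p2, Tri p0 p1 p2 → Tri (sc p0) (sc p2) (sc p1) := by decide
theorem tri_rev : ∀ p0 p1 p2, Tri p0 p1 p2 → Tri p0 p2 p1 := by decide
theorem sc_ne : ∀ p, sc p ≠ p := by decide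

set_option maxRecDepth 100000 in
theorem rr_spec : ∀ p0 p1 p2, Tri p0 p1 p2 → ∀ q0 q1 q2, Tri q0 q1 q2 →
    rr (p0, p1, p2, q0, q1, q2) ≠ p0 ∧ rr (p0, p1, p2, q0, q1, q2) ≠ q0 ∧
    rr (p0, p1, p2, q0, q1, q2) ≠ rr (p1, p2, p0, q1, q2, q0) := by decide

open Classical in
theorem coloring {X : Type*} [MeasurableSpace X] (A T T' : X → X) (mA : Measurable A)
    (mT : Measurable T) (mT' : Measurable T') (hA : ∀ x, A (A (A x)) = x)
    (hT : ∀ x, T (T' x) = x) (hT' : ∀ x, T' (T x) = x) (hTA : ∀ x, T (A x) = A (A (T x)))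
    (M : Set X) (mM : MeasurableSet M) (h1 : ∀ x ∈ M, A x ∉ M)
    (h2 : ∀ x ∈ M, T x ∉ M ∧ A (T x) ∉ M ∧ A (A (T x)) ∉ M)
    (h3 : ∀ x, ∃ y, (y = x ∨ y = T x ∨ y = T' x) ∧ (y ∈ M ∨ A y ∈ M ∨ A (A y) ∈ M)) :
    ∃ c : X → Fin 4, Measurable c ∧ (∀ x, c x ≠ c (A x)) ∧ ∀ x, c x ≠ c (T x) := by
  have hTA' : ∀ x, T' (A x) = A (A (T' x)) := by
    intro x
    have : T (A (A (T' x))) = A x := by rw [hTA, hTA, hT, hA]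
    rw [← this, hT']
  let K : Set X := {x | x ∈ M ∨ A x ∈ M ∨ A (A x) ∈ M}
  have mK : MeasurableSet K := mM.union ((mA mM).union (mA (mA mM)))
  let p : X → Fin 4 := fun x => if x ∈ M then 0 else if A (A x) ∈ M then 1 else 2
  have mp : Measurable p := Measurable.ite mM measurable_const
    (Measurable.ite (mA (mA mM)) measurable_const measurable_const)
  let P : X → Fin 4 := fun x => if x ∈ K then p x else sc (p (T' x))
  have mP : Measurable P := Measurable.ite mK mp
    ((Measurable.of_discrete (f := sc)).comp (mp.comp mT'))
  let R : X → Fin 4 := fun x => rr (P (T' x), P (T' (A x)), P (T' (A (A x))),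
    p (T x), p (T (A x)), p (T (A (A x))))
  have mR : Measurable R := by
    refine (Measurable.of_discrete (f := rr)).comp ?_
    fun_prop
  let c : X → Fin 4 := fun x => if x ∈ K then p x else if T x ∈ K then R x else sc (p (T' x))
  have mc : Measurable c := Measurable.ite mK mp (Measurable.ite (mT mK) mR
    ((Measurable.of_discrete (f := sc)).comp (mp.comp mT')))
  have KA : ∀ x, A x ∈ K ↔ x ∈ K := by
    intro x; simp only [K, Set.mem_ofPred_eq, hA]; tauto
  have KTA : ∀ x, T (A x) ∈ K ↔ T x ∈ K := by
    intro x; rw [hTA, KA, KA]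
  have KTA' : ∀ x, T' (A x) ∈ K ↔ T' x ∈ K := by
    intro x; rw [hTA', KA, KA]
  have F2 : ∀ x, x ∈ K → T x ∉ K := by
    have key : ∀ x, x ∈ M → T x ∉ K := by
      rintro x hx (h | h | h)
      · exact (h2 x hx).1 h
      · exact (h2 x hx).2.1 h
      · exact (h2 x hx).2.2 h
    rintro x (h | h | h)
    · exact key _ h
    · have := key _ h
      rwa [KTA] at this
    · have := key _ h
      rwa [KTA, KTA] at this
  have F3 : ∀ x, x ∈ K ∨ T x ∈ K ∨ T' x ∈ K := by
    intro x
    obtain ⟨y, rfl | rfl | rfl, hy⟩ := h3 x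
    · exact Or.inl hy
    · exact Or.inr (Or.inl hy)
    · exact Or.inr (Or.inr hy)
  have F4 : ∀ x, x ∈ K → Tri (p x) (p (A x)) (p (A (A x))) := by
    intro x hx
    have a1 := h1 x
    have a2 := h1 (A x)
    have a3 := h1 (A (A x))
    rw [hA] at a3
    simp only [p, hA]
    rcases hx with h | h | h
    · have b := a1 h
      have b' : A (A x) ∉ M := fun h' => a3 h' h
      simp [h, b, b']; decide
    · have b := a2 h
      have b' : x ∉ M := fun h' => a1 h' h
      simp [h, b, b']; decide
    · have b := a3 h
      have b' : A x ∉ M := fun h' => a2 h' h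
      simp [h, b, b']; decide
  have F5 : ∀ x, x ∈ K ∨ T' x ∈ K → Tri (P x) (P (A x)) (P (A (A x))) := by
    intro x hx
    by_cases hk : x ∈ K
    · have := F4 x hk
      simpa only [P, KA, hk, if_true] using this
    · have := F4 (T' x) (hx.resolve_left hk)
      simp only [P, KA, hk, if_false, hTA', hA]
      exact tri_sc _ _ _ this
  have F6 : ∀ x, T x ∈ K → rr (P (T' x), P (T' (A x)), P (T' (A (A x))),
      p (T x), p (T (A x)), p (T (A (A x)))) ≠ P (T' x) ∧ R x ≠ p (T x) ∧ R x ≠ R (A x) := by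
    intro x hx
    have g1 : T' x ∈ K ∨ T' (T' x) ∈ K := by
      rcases F3 (T' x) with h | h | h
      · exact Or.inl h
      · rw [hT] at h; exact (F2 x h hx).elim
      · exact Or.inr h
    have g2 := tri_rev _ _ _ (F5 _ g1)
    have g3 := tri_rev _ _ _ (F4 _ hx)
    have := rr_spec _ _ _ g2 _ _ _ g3
    simpa only [R, hTA, hTA', hA] using this
  refine ⟨c, mc, ?_, ?_⟩
  · intro x
    by_cases hx : x ∈ K
    · simp only [c, KA, hx, if_true]
      exact (F4 x hx).2.2.2.1
    · by_cases hy : T x ∈ K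
      · simp only [c, KA, KTA, hx, hy, if_true, if_false]
        exact (F6 x hy).2.2
      · simp only [c, KA, KTA, hx, hy, if_false, hTA']
        exact (tri_sc _ _ _ (F4 _ (((F3 x).resolve_left hx).resolve_left hy))).2.2.2.1
  · intro x
    by_cases hx : x ∈ K
    · have hy := F2 x hx
      by_cases hz : T (T x) ∈ K
      · have := (F6 _ hz).1
        simp only [c, hx, hy, hz, if_true, if_false]
        have hP : P (T' (T x)) = p x := by simp only [hT', P, hx, if_true]
        rw [hP] at this
        exact fun h => this (hP ▸ h.symm)
      · simp only [c, hx, hy, hz, if_true, if_false, hT']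
        exact (sc_ne _).symm
    · by_cases hy : T x ∈ K
      · simp only [c, hx, hy, if_true, if_false]
        exact (F6 x hy).2.1
      · have hz : T (T x) ∈ K := by
          rcases F3 (T x) with h | h | h
          · exact (hy h).elim
          · exact h
          · rw [hT'] at h; exact (hx h).elim
        have := (F6 _ hz).1
        simp only [c, hx, hy, hz, if_true, if_false]
        have hP : P (T' (T x)) = sc (p (T' x)) := by simp only [hT', P, hx, if_false]
        rw [hP] at this
        exact fun h => this (hP ▸ h.symm)

theorem upper : HasBorelColoring (ShiftAdj T3) 4 := by
  let K : Set Delta3 := {g | g ≠ 1 ∧ (toAdd g.right = 0 ∨ toAdd g.right = 1 ∨ toAdd g.right = -1)}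
  have hK : K.Finite := by
    have : K ⊆ Set.range (fun q : ZMod 3 × Fin 3 =>
      (⟨ofAdd q.1, ofAdd (if q.2 = 0 then 0 else if q.2 = 1 then 1 else -1 : ℤ)⟩ : Delta3)) := by
      rintro ⟨l, r⟩ ⟨-, h | h | h⟩
      · exact ⟨(toAdd l, 0), SemidirectProduct.ext rfl (by simpa using congrArg ofAdd h.symm)⟩
      · exact ⟨(toAdd l, 1), SemidirectProduct.ext rfl (by simpa using congrArg ofAdd h.symm)⟩
      · exact ⟨(toAdd l, 2), SemidirectProduct.ext rfl (by simpa using congrArg ofAdd h.symm)⟩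
    exact (Set.finite_range _).subset this
  have : Finite K := hK
  obtain ⟨M, mM, hM1, hM2⟩ := marker (X := FreePart Delta3) (fun g : K => act g.1)
    (fun g => act_meas _) (by
      rintro ⟨g, hg, hr⟩
      refine ⟨⟨g⁻¹, inv_ne_one.2 hg, ?_⟩, fun x => ?_⟩
      · simp only [SemidirectProduct.inv_right, toAdd_inv]; omega
      · simp only [act_act, inv_mul_cancel, act_one]) (fun g x => act_ne g.2.1 x)
  have ne_of_right : ∀ g : Delta3, toAdd g.right = 1 → g ≠ 1 := by
    rintro g hg rfl
    simp at hg
  obtain ⟨c, mc, hc1, hc2⟩ := coloring (act a) (act t) (act t⁻¹) (act_meas _) (act_meas _)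
    (act_meas _) (fun x => by simp only [act_act, aaa, act_one])
    (fun x => by simp only [act_act, mul_inv_cancel, act_one])
    (fun x => by simp only [act_act, inv_mul_cancel, act_one])
    (fun x => by simp only [act_act, ta]) M mM
    (fun x hx => hM1 x hx ⟨a, a_ne, Or.inl rfl⟩)
    (fun x hx => by
      simp only [act_act]
      exact ⟨hM1 x hx ⟨t, ne_of_right _ rfl, Or.inr (Or.inl rfl)⟩,
        hM1 x hx ⟨a * t, ne_of_right _ rfl, Or.inr (Or.inl rfl)⟩,
        hM1 x hx ⟨a * (a * t), ne_of_right _ rfl, Or.inr (Or.inl rfl)⟩⟩)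
    (fun x => by
      rcases hM2 x with h | ⟨⟨g, hg, hr⟩, h⟩
      · exact ⟨x, Or.inl rfl, Or.inl h⟩
      · refine ⟨act (t ^ (toAdd g.right)) x, ?_, ?_⟩
        · rcases hr with hr | hr | hr <;> simp [hr, act_one]
        · simp only [act_act]
          rcases dec g with e | e | e
          · left; rw [← e]; exact h
          · right; left; rw [← e]; exact h
          · right; right; rw [← e]; exact h)
  refine ⟨c, mc, ?_⟩
  rintro x y ⟨-, s, hs, hy⟩
  have hy : y = act s x := Subtype.ext hy
  rcases hs with rfl | rfl | rfl | rfl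
  · rw [hy]; exact hc1 x
  · rw [a2] at hy
    have : x = act a y := by rw [hy, act_act, aaa, act_one]
    rw [this]; exact (hc1 y).symm
  · rw [hy]; exact hc2 x
  · rw [tinv] at hy
    have : x = act t y := by rw [hy, act_act, mul_inv_cancel, act_one]
    rw [this]; exact (hc2 y).symm

end D3

namespace D3

theorem cyl {G : Type*} {U : Set (G → Bool)} (hU : IsOpen U) {u : G → Bool} (hu : u ∈ U) :
    ∃ D : Finset G, ∀ w : G → Bool, (∀ d ∈ D, w d = u d) → w ∈ U := by
  obtain ⟨I, v, h1, h2⟩ := isOpen_pi_iff.1 hU u hu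
  exact ⟨I, fun w hw => h2 fun d hd => by rw [hw d hd]; exact (h1 d hd).2⟩

theorem isOpen_ne {G : Type*} [Group G] (g : G) : IsOpen {x : G → Bool | shiftMap g x ≠ x} :=
  isOpen_ne_fun (shift_cont g) continuous_id

theorem free_eq (G : Type*) [Group G] :
    FreePart G = ⋂ g : {g : G // g ≠ 1}, {x : G → Bool | shiftMap g.1 x ≠ x} := by
  ext x; simp [FreePart]

theorem free_residual {G : Type*} [Group G] [Countable G] [Infinite G] :
    FreePart G ∈ residual (G → Bool) := by
  classical
  rw [free_eq, countable_iInter_mem]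
  rintro ⟨g, hg⟩
  refine residual_of_dense_open (isOpen_ne g) ?_
  rw [dense_iff_inter_open]
  rintro U hU ⟨u, hu⟩
  obtain ⟨D, hD⟩ := cyl hU hu
  obtain ⟨h, hh⟩ := Infinite.exists_notMem_finset D
  refine ⟨Function.update u h (!u (g⁻¹ * h)), hD _ fun d hd => ?_, fun e => ?_⟩
  · rw [Function.update_of_ne]
    rintro rfl; exact hh hd
  · have := congrFun e h
    have hne : g⁻¹ * h ≠ h := by simpa using hg
    simp [shiftMap, Function.update_of_ne hne] at this

theorem free_meas {G : Type*} [Group G] [Countable G] : MeasurableSet (FreePart G) := by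
  rw [free_eq]
  exact MeasurableSet.iInter fun g => (isOpen_ne g.1).measurableSet

def shiftHomeo {G : Type*} [Group G] (g : G) : (G → Bool) ≃ₜ (G → Bool) where
  toFun := shiftMap g
  invFun := shiftMap g⁻¹
  left_inv x := by rw [shift_mul, inv_mul_cancel, shift_one]
  right_inv x := by rw [shift_mul, mul_inv_cancel, shift_one]
  continuous_toFun := shift_cont g
  continuous_invFun := shift_cont g⁻¹

theorem shift_residual {G : Type*} [Group G] (g : G) :
    Filter.Tendsto (shiftMap g) (residual (G → Bool)) (residual (G → Bool)) :=
  tendsto_residual_of_isOpenMap (shift_cont g) (shiftHomeo g).isOpenMap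

theorem far (D : Finset Delta3) : ∃ n : ℕ, Odd n ∧ ∀ d ∈ D, (t ^ n)⁻¹ * d ∉ D := by
  let B : ℕ := ∑ d ∈ D, (toAdd d.right).natAbs
  have hB : ∀ d ∈ D, (toAdd d.right).natAbs ≤ B := fun d hd =>
    Finset.single_le_sum (f := fun d : Delta3 => (toAdd d.right).natAbs) (fun _ _ => Nat.zero_le _) hd
  refine ⟨2 * B + 1, ⟨B, rfl⟩, fun d hd h => ?_⟩
  have e1 := hB _ hd
  have e2 := hB _ h
  have e3 : ∀ n : ℕ, toAdd (t ^ n).right = n := by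
    intro n
    have : (t ^ n).right = t.right ^ n := map_pow SemidirectProduct.rightHom t n
    rw [this, t_right]; simp
  simp only [SemidirectProduct.mul_right, SemidirectProduct.inv_right, toAdd_mul, toAdd_inv, e3] at e2
  push_cast at e2
  omega

theorem no_flip (S : Set (FreePart Delta3)) (hS : MeasurableSet S)
    (h : ∀ x, act t x ∈ S ↔ x ∉ S) : False := by
  classical
  have hm : MeasurableSet (Subtype.val '' S) := free_meas.subtype_image hS
  obtain ⟨U, hU, hSU⟩ := hm.residualEq_isOpen
  rw [Filter.eventuallyEq_set] at hSU
  have hR : ∀ᶠ x in residual (Delta3 → Bool), ∃ hx : x ∈ FreePart Delta3,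
      ((⟨x, hx⟩ : FreePart Delta3) ∈ S ↔ x ∈ U) := by
    filter_upwards [hSU, free_residual] with x hx hF
    refine ⟨hF, ?_⟩
    rw [← hx]
    simp [hF]
  have hR2 : ∀ g : Delta3, ∀ V : Set (Delta3 → Bool), IsOpen V → V.Nonempty →
      ∃ x : FreePart Delta3, x.1 ∈ V ∧ (x ∈ S ↔ x.1 ∈ U) ∧ (act g x ∈ S ↔ (act g x).1 ∈ U) := by
    intro g V hV hVn
    have := dense_of_mem_residual (Filter.inter_mem hR ((shift_residual g) hR))
    obtain ⟨x, hxV, ⟨h1, h2⟩, ⟨h3, h4⟩⟩ := this.inter_open_nonempty V hV hVn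
    exact ⟨⟨x, h1⟩, hxV, h2, h4⟩
  have hodd : ∀ n : ℕ, ∀ x, (act (t ^ (2 * n)) x ∈ S ↔ x ∈ S) := by
    intro n
    induction n with
    | zero => intro x; simp [act_one]
    | succ n ih =>
      intro x
      have : t ^ (2 * (n + 1)) = t * (t * t ^ (2 * n)) := by
        rw [mul_add, pow_add, mul_one, ← mul_assoc, ← pow_two, ← pow_add, ← pow_add, add_comm]
      rw [this, ← act_act, ← act_act, h, h, not_not, ih]
  obtain ⟨x, -, h1, h2⟩ := hR2 t Set.univ isOpen_univ Set.univ_nonempty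
  obtain ⟨u, hu⟩ : U.Nonempty := by
    by_cases hx : x ∈ S
    · exact ⟨_, h1.1 hx⟩
    · exact ⟨_, h2.1 ((h x).2 hx)⟩
  obtain ⟨D, hD⟩ := cyl hU hu
  obtain ⟨n, ⟨k, hk⟩, hn⟩ := far D
  obtain ⟨w, hwV, hw1, hw2⟩ := hR2 (t ^ n) (U ∩ shiftMap (t ^ n) ⁻¹' U)
    (hU.inter (hU.preimage (shift_cont _)))
    ⟨fun g => if g ∈ D then u g else u (t ^ n * g), hD _ fun d hd => by simp [hd],
      hD _ fun d hd => by
        simp only [shiftMap, hn d hd, if_false, mul_inv_cancel_left]⟩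
  have hwS := hw1.2 hwV.1
  have hwS2 := hw2.2 hwV.2
  rw [hk, pow_succ', ← act_act, h, hodd] at hwS2
  exact hwS2 hwS

set_option maxRecDepth 100000 in
theorem fin3 : ∀ x ax aax : Fin 3, x ≠ ax → ax ≠ aax → aax ≠ x → ∀ tx, x ≠ tx → ∀ aatx, ax ≠ aatx →
    ∀ atx, aax ≠ atx → tx ≠ atx → atx ≠ aatx → aatx ≠ tx → (atx = tx + 1 ↔ ¬ ax = x + 1) := by decide

theorem lower : ¬ HasBorelColoring (ShiftAdj T3) 3 := by
  rintro ⟨c, mc, hc⟩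
  have hcA : ∀ x, c x ≠ c (act a x) := fun x =>
    hc _ _ ⟨(act_ne a_ne x).symm, a, by simp [T3, a], rfl⟩
  have hcT : ∀ x, c x ≠ c (act t x) := fun x =>
    hc _ _ ⟨(act_ne (by
      intro h; have := congrArg SemidirectProduct.right h; revert this; simp [t]) x).symm, t,
      by simp [T3, t], rfl⟩
  have hA : ∀ x : FreePart Delta3, act a (act a (act a x)) = x := fun x => by
    simp only [act_act, aaa, act_one]
  have hTA : ∀ x : FreePart Delta3, act t (act a x) = act a (act a (act t x)) := fun x => by
    simp only [act_act, ta]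
  refine no_flip {x | c (act a x) = c x + 1} ?_ ?_
  · exact measurableSet_eq_fun (mc.comp (act_meas a)) ((Measurable.of_discrete (f := fun i : Fin 3 => i + 1)).comp mc)
  · intro x
    have e1 := hcA x
    have e2 := hcA (act a x)
    have e3 := hcA (act a (act a x))
    have f1 := hcA (act t x)
    have f2 := hcA (act a (act t x))
    have f3 := hcA (act a (act a (act t x)))
    have g1 := hcT x
    have g2 := hcT (act a x)
    have g3 := hcT (act a (act a x))
    rw [hTA, hTA, hA] at g3
    rw [hTA] at g2
    rw [hA] at e3 f3
    exact fin3 _ _ _ e1 e2 e3 _ g1 _ g2 _ g3 f1 f2 f3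

end D3

/-- The Borel chromatic number of the shift graph of
`(ℤ/3ℤ ⋊_φ ℤ, {(1,0),(2,0),(0,1),(0,-1)})` equals `4`. -/
theorem borelChromatic_shift_Delta3 : borelChromatic (ShiftAdj T3) = 4 := by
  refine le_antisymm (Nat.sInf_le D3.upper) (le_csInf ⟨4, D3.upper⟩ ?_)
  rintro n ⟨c, mc, hc⟩
  by_contra hn
  have hn : n ≤ 3 := by omega
  exact D3.lower ⟨fun x => Fin.castLE hn (c x), (Measurable.of_discrete (f := Fin.castLE hn)).comp mc,
    fun x y h e => hc x y h (Fin.castLE_injective hn e)⟩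
end

section
/- Let Γ = (ℤ/3ℤ) × ℤ and Δ = (ℤ/3ℤ) ⋊_φ ℤ (φ sending 1 to inversion), each with generating set S = {(1,0),(2,0),(0,1),(0,-1)}. Then the map (i,n) ↦ ((-1)^n · i, n) is a graph isomorphism from the Cayley graph Cay(Γ,S) to the Cayley graph Cay(Δ,S). -/
open Multiplicative

/-- The marked group `Γ = ℤ/3ℤ × ℤ` (written multiplicatively). -/
abbrev Gamma3 : Type := Multiplicative (ZMod 3 × ℤ)

/-- The generating set `S = {(1,0), (2,0), (0,1), (0,-1)}` of `Γ`. -/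
def S3 : Set Gamma3 :=
  {ofAdd ((1 : ZMod 3), (0 : ℤ)), ofAdd ((2 : ZMod 3), (0 : ℤ)),
   ofAdd ((0 : ZMod 3), (1 : ℤ)), ofAdd ((0 : ZMod 3), (-1 : ℤ))}

/-- The map `(i, n) ↦ ((-1)ⁿ · i, n)` from `Γ` to `Δ`. -/
def isoMap : Gamma3 → Delta3 := fun x =>
  ⟨ofAdd ((((toAdd x).2.negOnePow : ℤ) : ZMod 3) * (toAdd x).1), ofAdd (toAdd x).2⟩

lemma phi3_one (a : Multiplicative (ZMod 3)) : phi3 (ofAdd (1 : ℤ)) a = a⁻¹ := by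
  simp [phi3, zpowersHom_apply]

lemma phi3_zero (a : Multiplicative (ZMod 3)) : phi3 (ofAdd (0 : ℤ)) a = a := by
  simp [phi3, zpowersHom_apply]

lemma phi3_neg_one (a : Multiplicative (ZMod 3)) : phi3 (ofAdd (-1 : ℤ)) a = a⁻¹ := by
  have h : phi3 (ofAdd (1 : ℤ)) (phi3 (ofAdd (-1 : ℤ)) a) = a := by
    rw [← MulAut.mul_apply, ← map_mul, ← ofAdd_add]
    exact phi3_zero a
  rw [phi3_one] at h
  rw [← h, inv_inv, h]

/-- The sign `(-1)ⁿ` in `ℤ/3ℤ`. -/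
def sgn3 (n : ℤ) : ZMod 3 := ((n.negOnePow : ℤ) : ZMod 3)

lemma sgn3_cases (n : ℤ) : sgn3 n = 1 ∨ sgn3 n = -1 := by
  rcases Int.even_or_odd n with h | h
  · left; simp [sgn3, Int.negOnePow_even n h]
  · right; simp [sgn3, Int.negOnePow_odd n h]

lemma sgn3_succ (n : ℤ) : sgn3 (1 + n) = -sgn3 n := by
  simp [sgn3, Int.negOnePow_add]

lemma sgn3_pred (n : ℤ) : sgn3 (-1 + n) = -sgn3 n := by
  simp [sgn3, Int.negOnePow_add]

lemma isoMap_ofAdd (i : ZMod 3) (n : ℤ) :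
    isoMap (ofAdd (i, n)) = ⟨ofAdd (sgn3 n * i), ofAdd n⟩ := rfl

lemma isoMap_bijective : Function.Bijective isoMap := by
  have hs : ∀ n, sgn3 n * sgn3 n = 1 := fun n => by
    rcases sgn3_cases n with h | h <;> rw [h] <;> decide
  refine Function.bijective_iff_has_inverse.2
    ⟨fun y => ofAdd (sgn3 (toAdd y.right) * toAdd y.left, toAdd y.right), ?_, ?_⟩
  · intro x
    obtain ⟨⟨i, n⟩, rfl⟩ := ofAdd.surjective x
    rw [isoMap_ofAdd]
    simp [← mul_assoc, hs]
  · rintro ⟨a, b⟩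
    rw [isoMap_ofAdd]
    simp [← mul_assoc, hs]

lemma mem_left (i j : ZMod 3) (n m : ℤ) :
    (∃ s ∈ S3, (ofAdd (j, m) : Gamma3) = s * ofAdd (i, n)) ↔
    (j = 1 + i ∧ m = n) ∨ (j = 2 + i ∧ m = n) ∨ (j = i ∧ m = 1 + n) ∨
      (j = i ∧ m = -1 + n) := by
  simp [S3, ← ofAdd_add]

lemma mem_right (i j : ZMod 3) (n m : ℤ) :
    (∃ s ∈ T3, (⟨ofAdd j, ofAdd m⟩ : Delta3) = s * ⟨ofAdd i, ofAdd n⟩) ↔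
    (j = 1 + i ∧ m = n) ∨ (j = 2 + i ∧ m = n) ∨ (j = -i ∧ m = 1 + n) ∨
      (j = -i ∧ m = -1 + n) := by
  simp only [T3, Set.mem_insert_iff, Set.mem_singleton_iff, exists_eq_or_imp, exists_eq_left]
  simp only [SemidirectProduct.ext_iff,
    SemidirectProduct.mul_left, SemidirectProduct.mul_right, phi3_one, phi3_zero, phi3_neg_one,
    ← ofAdd_add, ← ofAdd_neg, ofAdd.injective.eq_iff, zero_add]

/-- The map `(i, n) ↦ ((-1)ⁿ · i, n)` is a graph isomorphism from
`Cay(Γ, S)` to `Cay(Δ, S)`. -/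
theorem isoMap_is_cayley_isomorphism :
    Function.Bijective isoMap ∧
    ∀ g h : Gamma3, CayleyAdj S3 g h ↔ CayleyAdj T3 (isoMap g) (isoMap h) := by
  refine ⟨isoMap_bijective, fun g h => ?_⟩
  unfold CayleyAdj
  refine and_congr isoMap_bijective.injective.ne_iff.symm ?_
  obtain ⟨⟨i, n⟩, rfl⟩ := ofAdd.surjective g
  obtain ⟨⟨j, m⟩, rfl⟩ := ofAdd.surjective h
  rw [isoMap_ofAdd, isoMap_ofAdd, mem_left, mem_right]
  have key0 : ∀ e : ZMod 3, e = 1 ∨ e = -1 → ∀ i j : ZMod 3,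
      ((j = 1 + i ∨ j = 2 + i) ↔ (e * j = 1 + e * i ∨ e * j = 2 + e * i)) := by decide
  have key1 : ∀ e : ZMod 3, e = 1 ∨ e = -1 → ∀ i j : ZMod 3,
      (j = i ↔ -e * j = -(e * i)) := by decide
  have h0 := key0 _ (sgn3_cases n) i j
  have h1 := key1 _ (sgn3_cases n) i j
  have e0 : (j = 1 + i ∧ m = n ∨ j = 2 + i ∧ m = n) ↔
      (sgn3 m * j = 1 + sgn3 n * i ∧ m = n ∨ sgn3 m * j = 2 + sgn3 n * i ∧ m = n) := by
    rw [← or_and_right, ← or_and_right]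
    refine and_congr_left fun hm => ?_
    subst hm
    exact h0
  have e1 : (j = i ∧ m = 1 + n) ↔ (sgn3 m * j = -(sgn3 n * i) ∧ m = 1 + n) := by
    refine and_congr_left fun hm => ?_
    rw [hm, sgn3_succ]
    exact h1
  have e2 : (j = i ∧ m = -1 + n) ↔ (sgn3 m * j = -(sgn3 n * i) ∧ m = -1 + n) := by
    refine and_congr_left fun hm => ?_
    rw [hm, sgn3_pred]
    exact h1
  rw [← or_assoc, e0, e1, e2, or_assoc]
end
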